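/- arXiv:1802.09694 — 6 statements merged into one kernel-verified Lean document; each statement's English description precedes it below -/
import Mathlib

section
/- Let ρ be a definite 3-form on a 6-dimensional real vector space V. Then there exists a complex structure J on V compatible with ρ, and there are exactly two such complex structures, namely J and -J. -/
/-- The contraction `i_v ρ` of an alternating 3-form, viewed as the linear map
`x ↦ (z ↦ ρ (v, x, z))` from `V` to the space of 1-forms. -/
noncomputable def contraction3 {V : Type*} [AddCommGroup V] [Module ℝ V]
    (ρ : V [⋀^Fin 3]→ₗ[ℝ] ℝ) (v : V) : V →ₗ[ℝ] (V [⋀^Fin 1]→ₗ[ℝ] ℝ) :=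
  AlternatingMap.curryLeft (ρ.curryLeft v)

/-- A 3-form on a (6-dimensional) real vector space is *definite* if for every
nonzero `v` the contraction `i_v ρ` has rank 4. -/
def IsDefinite3Form {V : Type*} [AddCommGroup V] [Module ℝ V]
    (ρ : V [⋀^Fin 3]→ₗ[ℝ] ℝ) : Prop :=
  ∀ v : V, v ≠ 0 →
    Module.finrank ℝ (LinearMap.range (contraction3 ρ v)) = 4

/-- A complex structure `J` (i.e. `J ∘ J = -id`) is *compatible* with a 3-form `ρ`
if `ρ(Jx, Jy, z) = -ρ(x, y, z)` for all `x, y, z`. -/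
def IsCompatibleComplexStructure {V : Type*} [AddCommGroup V] [Module ℝ V]
    (ρ : V [⋀^Fin 3]→ₗ[ℝ] ℝ) (J : V →ₗ[ℝ] V) : Prop :=
  J ∘ₗ J = -LinearMap.id ∧ ∀ x y z : V, ρ ![J x, J y, z] = - ρ ![x, y, z]

section TrilinearForm

theorem update_vec3_zero {V : Type*} (x y z t : V) : Function.update ![x, y, z] 0 t = ![t, y, z] := by
  ext i
  fin_cases i <;> rfl

theorem update_vec3_one {V : Type*} (x y z t : V) : Function.update ![x, y, z] 1 t = ![x, t, z] := by
  ext i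
  fin_cases i <;> rfl

theorem update_vec3_two {V : Type*} (x y z t : V) : Function.update ![x, y, z] 2 t = ![x, y, t] := by
  ext i
  fin_cases i <;> rfl

variable {V : Type*} [AddCommGroup V] [Module ℝ V]

/-- An alternating 3-form as a curried trilinear form. -/
def AlternatingMap.toTrilinear (ρ : V [⋀^Fin 3]→ₗ[ℝ] ℝ) : V →ₗ[ℝ] V →ₗ[ℝ] V →ₗ[ℝ] ℝ where
  toFun x := LinearMap.mk₂ ℝ (fun y z => ρ ![x, y, z])
    (fun y y' z => by
      simpa only [update_vec3_one] using ρ.map_update_add ![x, 0, z] 1 y y')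
    (fun c y z => by
      simpa only [update_vec3_one] using ρ.map_update_smul ![x, 0, z] 1 c y)
    (fun y z z' => by
      simpa only [update_vec3_two] using ρ.map_update_add ![x, y, 0] 2 z z')
    (fun c y z => by
      simpa only [update_vec3_two] using ρ.map_update_smul ![x, y, 0] 2 c z)
  map_add' x x' := by
    ext y z
    have h := ρ.map_update_add ![0, y, z] 0 x x'
    simp only [update_vec3_zero] at h
    simpa using h
  map_smul' c x := by
    ext y z
    have h := ρ.map_update_smul ![0, y, z] 0 c x
    simp only [update_vec3_zero] at h
    simpa using h

theorem AlternatingMap.toTrilinear_apply (ρ : V [⋀^Fin 3]→ₗ[ℝ] ℝ) (x y z : V) :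
    ρ.toTrilinear x y z = ρ ![x, y, z] := rfl

theorem contraction3_apply (ρ : V [⋀^Fin 3]→ₗ[ℝ] ℝ) (x y z : V) :
    contraction3 ρ x y ![z] = ρ ![x, y, z] := rfl

theorem ker_toTrilinear (ρ : V [⋀^Fin 3]→ₗ[ℝ] ℝ) (v : V) :
    LinearMap.ker (ρ.toTrilinear v) = LinearMap.ker (contraction3 ρ v) := by
  ext y
  simp only [LinearMap.mem_ker]
  constructor
  · intro h
    ext u
    have hu : u = ![u 0] := by
      ext i
      fin_cases i
      rfl
    rw [hu, contraction3_apply, ← ρ.toTrilinear_apply, h]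
    rfl
  · intro h
    ext z
    rw [ρ.toTrilinear_apply, ← contraction3_apply, h]
    rfl

/-- A trilinear form is alternating, in the form of antisymmetry in neighbouring arguments. -/
def IsAntisymm3 (T : V →ₗ[ℝ] V →ₗ[ℝ] V →ₗ[ℝ] ℝ) : Prop :=
  (∀ a b, T a b = -T b a) ∧ ∀ a b c, T a b c = -T a c b

theorem AlternatingMap.isAntisymm3_toTrilinear (ρ : V [⋀^Fin 3]→ₗ[ℝ] ℝ) :
    IsAntisymm3 ρ.toTrilinear := by
  constructor
  · intro a b
    ext c
    have h := ρ.map_swap ![a, b, c] (i := 0) (j := 1) (by decide)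
    have e : ![a, b, c] ∘ Equiv.swap (0 : Fin 3) 1 = ![b, a, c] := by
      ext i
      fin_cases i <;> rfl
    rw [e] at h
    simp [AlternatingMap.toTrilinear_apply, h]
  · intro a b c
    have h := ρ.map_swap ![a, b, c] (i := 1) (j := 2) (by decide)
    have e : ![a, b, c] ∘ Equiv.swap (1 : Fin 3) 2 = ![a, c, b] := by
      ext i
      fin_cases i <;> rfl
    rw [e] at h
    simp [AlternatingMap.toTrilinear_apply, h]

namespace IsAntisymm3

variable {T : V →ₗ[ℝ] V →ₗ[ℝ] V →ₗ[ℝ] ℝ}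

theorem self (hT : IsAntisymm3 T) (a : V) : T a a = 0 := by
  ext c
  have h := congrArg (fun f => f c) (hT.1 a a)
  simp only [LinearMap.neg_apply] at h
  simp only [LinearMap.zero_apply]
  linarith

theorem self_right (hT : IsAntisymm3 T) (a b : V) : T a b b = 0 := by
  have h := hT.2 a b b
  linarith

theorem self_outer (hT : IsAntisymm3 T) (a b : V) : T a b a = 0 := by
  rw [hT.2, hT.self]
  simp

theorem swap_eq_zero (hT : IsAntisymm3 T) {a b : V} (h : T a b = 0) : T b a = 0 := by
  rw [hT.1, h, neg_zero]

theorem rotate (hT : IsAntisymm3 T) (a b c : V) : T a b c = T b c a := by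
  rw [hT.1, hT.2 b c a]
  simp

/-- For a form whose contractions have two-dimensional kernels, the relation `T a b = 0`
is transitive through nonzero vectors. -/
theorem trans [FiniteDimensional ℝ V] (hT : IsAntisymm3 T)
    (hk : ∀ v ≠ 0, Module.finrank ℝ (LinearMap.ker (T v)) = 2)
    {a b c : V} (hb : b ≠ 0) (hab : T a b = 0) (hbc : T b c = 0) : T a c = 0 := by
  by_contra hac
  have hli : LinearIndependent ℝ ![a, b, c] := by
    rw [Fintype.linearIndependent_iff]
    intro s hs
    simp only [Fin.sum_univ_three, Matrix.cons_val] at hs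
    have h2 : s 2 = 0 := by
      have h := congrArg (T a) hs
      simpa [hab, hT.self, hac] using h
    have h0 : s 0 = 0 := by
      have hca : T c a ≠ 0 := fun h => hac (hT.swap_eq_zero h)
      have h := congrArg (T c) hs
      simpa [hT.swap_eq_zero hbc, hT.self, hca] using h
    have h1 : s 1 = 0 := by simpa [h0, h2, hb] using hs
    intro i
    fin_cases i <;> assumption
  have hle : Submodule.span ℝ (Set.range ![a, b, c]) ≤ LinearMap.ker (T b) := by
    rw [Submodule.span_le]
    rintro _ ⟨i, rfl⟩
    fin_cases i
    · exact hT.swap_eq_zero hab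
    · exact hT.self b
    · exact hbc
  have h := Submodule.finrank_mono hle
  rw [finrank_span_eq_card hli, hk b hb] at h
  simp at h

theorem exists_mem_ker_notMem_span [FiniteDimensional ℝ V]
    (hk : ∀ v ≠ 0, Module.finrank ℝ (LinearMap.ker (T v)) = 2) {v : V} (hv : v ≠ 0) :
    ∃ w, T v w = 0 ∧ w ∉ Submodule.span ℝ {v} := by
  by_contra! h
  have hle : LinearMap.ker (T v) ≤ Submodule.span ℝ {v} := fun w hw => h w hw
  have h := Submodule.finrank_mono hle
  rw [hk v hv, finrank_span_singleton hv] at h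
  omega

theorem exists_ne_zero (hdim : Module.finrank ℝ V = 6)
    (hk : ∀ v ≠ 0, Module.finrank ℝ (LinearMap.ker (T v)) = 2) {v : V} (hv : v ≠ 0) :
    ∃ x, T v x ≠ 0 := by
  by_contra! h
  have hker : LinearMap.ker (T v) = ⊤ := by
    rw [eq_top_iff]
    exact fun x _ => h x
  have h := hk v hv
  rw [hker, finrank_top, hdim] at h
  omega

end IsAntisymm3

theorem exists_dual_pair {g h : V →ₗ[ℝ] ℝ} (hgh : ∀ s t : ℝ, s • g + t • h = 0 → s = 0 ∧ t = 0) :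
    ∃ p q, g p = 1 ∧ h p = 0 ∧ g q = 0 ∧ h q = 1 := by
  have key : ∀ {g h : V →ₗ[ℝ] ℝ}, (∀ s t : ℝ, s • g + t • h = 0 → s = 0 ∧ t = 0) →
      ∃ p, g p = 1 ∧ h p = 0 := by
    intro g h hgh
    have hex : ∃ p, h p = 0 ∧ g p ≠ 0 := by
      by_contra! hc
      have hm := mem_span_of_iInf_ker_le_ker (L := fun _ : Unit => h) (K := g)
        (by simpa [SetLike.le_def] using hc)
      rw [Set.range_const, Submodule.mem_span_singleton] at hm
      obtain ⟨c, hc⟩ := hm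
      have := (hgh 1 (-c) (by rw [← hc]; module)).1
      norm_num at this
    obtain ⟨p, hp, hgp⟩ := hex
    exact ⟨(g p)⁻¹ • p, by simp [hgp], by simp [hp]⟩
  obtain ⟨p, hp⟩ := key hgh
  obtain ⟨q, hq⟩ := key (g := h) (h := g) fun s t hst =>
    (hgh t s (by rw [add_comm]; exact hst)).symm
  exact ⟨p, q, hp.1, hp.2, hq.2, hq.1⟩

namespace IsAntisymm3

variable {T : V →ₗ[ℝ] V →ₗ[ℝ] V →ₗ[ℝ] ℝ}

theorem exists_basis (hT : IsAntisymm3 T) [FiniteDimensional ℝ V] (hdim : Module.finrank ℝ V = 6)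
    {v w x y p q : V} (hvw : ∀ s t : ℝ, s • v + t • w = 0 → s = 0 ∧ t = 0)
    (h1 : T v w = 0) (h2 : T x y = 0)
    (hxp : T v x p = 1) (hyp : T v y p = 0) (hxq : T v x q = 0) (hyq : T v y q ≠ 0) :
    ∃ b : Module.Basis (Fin 6) ℝ V, ⇑b = ![v, w, x, y, p, q] := by
  have hxw : T v x w = 0 := by rw [hT.2, h1]; simp
  have hyw : T v y w = 0 := by rw [hT.2, h1]; simp
  have hxy : T v x y = 0 := by rw [hT.rotate, h2]; simp
  have hyx : T v y x = 0 := by rw [hT.2, hxy]; simp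
  have hli : LinearIndependent ℝ ![v, w, x, y, p, q] := by
    rw [Fintype.linearIndependent_iff]
    intro s hs
    simp only [Fin.sum_univ_six, Matrix.cons_val] at hs
    have h4 : s 4 = 0 := by
      have h := congrArg (T v x) hs
      simpa [hT.self_right, hT.self_outer, hxw, hxy, hxp, hxq] using h
    have h5 : s 5 = 0 := by
      have h := congrArg (T v y) hs
      simpa [hT.self_right, hT.self_outer, hyw, hyx, hyp, hyq] using h
    have h := congrArg (T v) hs
    simp only [h4, h5, map_add, map_smul, h1, hT.self, map_zero, zero_smul, smul_zero, add_zero,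
      zero_add] at h
    have h2 : s 2 = 0 := by
      simpa [hxp, hyp] using congrArg (fun f => f p) h
    have h3 : s 3 = 0 := by
      simpa [hxq, hyq] using congrArg (fun f => f q) h
    obtain ⟨h0, h1⟩ := hvw (s 0) (s 1) (by simpa [h2, h3, h4, h5] using hs)
    intro i
    fin_cases i <;> assumption
  refine ⟨basisOfLinearIndependentOfCardEqFinrank hli (by simp [hdim]), ?_⟩
  simp

/-- Normal form of the pencil of contractions by two transversal kernels. -/
theorem exists_normalized_pencil (hT : IsAntisymm3 T) [FiniteDimensional ℝ V]
    (hdim : Module.finrank ℝ V = 6)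
    (hk : ∀ v ≠ 0, Module.finrank ℝ (LinearMap.ker (T v)) = 2) :
    ∃ v w x y, T v w = 0 ∧ T x y = 0 ∧ T w x = T v y ∧ T w y = -T v x ∧
      ∀ s t : ℝ, s • T v x + t • T v y = 0 → s = 0 ∧ t = 0 := by
  have : Nontrivial V := Module.nontrivial_of_finrank_pos (R := ℝ) (by omega)
  obtain ⟨v, hv⟩ := exists_ne (0 : V)
  obtain ⟨w, hvw, hw⟩ := exists_mem_ker_notMem_span hk hv
  obtain ⟨x, hvx⟩ := exists_ne_zero hdim hk hv
  have hx : x ≠ 0 := by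
    rintro rfl
    simp at hvx
  obtain ⟨y, hxy, hy⟩ := exists_mem_ker_notMem_span hk hx
  have pair : ∀ {a b : V}, a ≠ 0 → b ∉ Submodule.span ℝ {a} →
      ∀ s t : ℝ, s • a + t • b = 0 → s = 0 ∧ t = 0 := by
    intro a b ha hb s t hst
    have ht : t = 0 := by
      by_contra ht
      apply hb
      rw [Submodule.mem_span_singleton]
      refine ⟨-(t⁻¹ * s), ?_⟩
      have h := congrArg (fun u => t⁻¹ • u) hst
      simp only [smul_add, smul_smul, inv_mul_cancel₀ ht, one_smul, smul_zero] at h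
      rw [neg_smul]
      exact (eq_neg_of_add_eq_zero_right h).symm
    refine ⟨?_, ht⟩
    simpa [ht, ha] using hst
  have nz : ∀ k k', k ≠ 0 → k' ≠ 0 → T v k = 0 → T x k' = 0 → T k k' ≠ 0 := by
    intro k k' hk0 hk0' h1 h2 h3
    exact hvx (hT.trans hk hk0' (hT.trans hk hk0 h1 h3) (hT.swap_eq_zero h2))
  have indep : ∀ y', T x y' = 0 → (∀ s t : ℝ, s • x + t • y' = 0 → s = 0 ∧ t = 0) →
      ∀ s t : ℝ, s • T v x + t • T v y' = 0 → s = 0 ∧ t = 0 := by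
    intro y' hxy' hp s t hst
    apply hp
    by_contra h
    exact nz v _ hv h (hT.self v) (by simp [hT.self, hxy']) (by simpa using hst)
  obtain ⟨p, q, hp1, hp2, hq1, hq2⟩ := exists_dual_pair (indep y hxy (pair hx hy))
  obtain ⟨b, hb⟩ := hT.exists_basis hdim (pair hv hw) hvw hxy hp1 hp2 hq1 (by simp [hq2])
  have expand : ∀ f : V →ₗ[ℝ] ℝ, f v = 0 → f w = 0 → f x = 0 → f y = 0 →
      f = f p • T v x + f q • T v y := by
    intro f h1 h2 h3 h4
    refine b.ext fun i => ?_
    rw [hb]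
    fin_cases i <;>
      simp [h1, h2, h3, h4, hp1, hp2, hq1, hq2, hT.self_outer, hT.self_right, hT.2 v _ w, hvw,
        hT.rotate v x y, hT.rotate v y x, hxy, hT.swap_eq_zero hxy]
  have hwx := expand (T w x) (by rw [← hT.rotate, hvw]; simp) (hT.self_outer _ _)
    (hT.self_right _ _) (by rw [hT.rotate, hxy]; simp)
  have hwy := expand (T w y) (by rw [← hT.rotate, hvw]; simp) (hT.self_outer _ _)
    (by rw [hT.rotate, hT.swap_eq_zero hxy]; simp) (hT.self_right _ _)
  generalize T w x p = a at hwx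
  generalize T w x q = b at hwx
  generalize T w y p = c at hwy
  generalize T w y q = d at hwy
  have hb0 : b ≠ 0 := by
    rintro rfl
    refine nz (w - a • v) x ?_ hx (by simp [hvw, hT.self]) (hT.self x) (by simp [hwx])
    intro h
    have := (pair hv hw (-a) 1 (by rw [← h]; module)).2
    norm_num at this
  obtain ⟨m, hm⟩ : ∃ m : ℝ, m = (a + d) / 2 := ⟨_, rfl⟩
  obtain ⟨s, hs⟩ : ∃ s : ℝ, s = (d - a) / 2 := ⟨_, rfl⟩
  obtain ⟨e, he⟩ : ∃ e : ℝ, e = b * c + s ^ 2 := ⟨_, rfl⟩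
  have h1 : T (w - m • v) x = T v (b • y - s • x) := by
    simp only [map_sub, map_smul, LinearMap.sub_apply, LinearMap.smul_apply, hwx, hm, hs]
    module
  have h2 : T (w - m • v) (b • y - s • x) = e • T v x := by
    simp only [map_sub, map_smul, LinearMap.sub_apply, LinearMap.smul_apply, hwx, hwy, hm, hs, he]
    module
  have hw' : ∀ r : ℝ, w - m • v + r • v ≠ 0 := by
    intro r h
    have := (pair hv hw (r - m) 1 (by rw [← h]; module)).2
    norm_num at this
  have hy' : ∀ r : ℝ, b • y - s • x - r • x ≠ 0 := by
    intro r h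
    exact hb0 (pair hx hy (-s - r) b (by rw [← h]; module)).2
  have he0 : e < 0 := by
    by_contra! he0
    refine nz _ _ (hw' √e) (hy' √e) (by simp [hvw, hT.self]) (by simp [hxy, hT.self]) ?_
    generalize b • y - s • x = y' at h1 h2 ⊢
    generalize w - m • v = w' at h1 h2 ⊢
    rw [map_add, LinearMap.add_apply, map_sub, map_sub, h2, map_smul, map_smul,
      LinearMap.smul_apply, LinearMap.smul_apply, map_smul, h1, smul_smul, Real.mul_self_sqrt he0]
    abel
  obtain ⟨r, hr, hr2⟩ : ∃ r : ℝ, r ≠ 0 ∧ r * r = -e :=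
    ⟨√(-e), (Real.sqrt_pos.2 (by linarith)).ne', Real.mul_self_sqrt (by linarith)⟩
  refine ⟨v, r⁻¹ • (w - m • v), x, r⁻¹ • (b • y - s • x), by simp [hvw, hT.self],
    by simp [hxy, hT.self], ?_, ?_, ?_⟩
  · rw [map_smul, LinearMap.smul_apply, h1, map_smul]
  · rw [map_smul, map_smul, LinearMap.smul_apply, h2, smul_smul, smul_smul, ← neg_one_smul ℝ (T v x)]
    congr 1
    field_simp
    linarith
  · refine indep _ (by simp [hxy, hT.self]) fun s' t' h => ?_
    obtain ⟨h3, h4⟩ := pair hx hy (s' - t' * r⁻¹ * s) (t' * r⁻¹ * b) (by rw [← h]; module)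
    have ht : t' = 0 := by simpa [hr, hb0] using h4
    exact ⟨by simpa [ht] using h3, ht⟩

/-- Every such form is the real part of the complex determinant in a suitable basis. -/
theorem exists_normal_basis (hT : IsAntisymm3 T) [FiniteDimensional ℝ V]
    (hdim : Module.finrank ℝ V = 6)
    (hk : ∀ v ≠ 0, Module.finrank ℝ (LinearMap.ker (T v)) = 2) :
    ∃ (v w x y p q : V) (b : Module.Basis (Fin 6) ℝ V), ⇑b = ![v, w, x, y, p, q] ∧
      T v w = 0 ∧ T x y = 0 ∧ T p q = 0 ∧ T w x = T v y ∧ T w y = -T v x ∧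
      T v x p = 1 ∧ T v y p = 0 ∧ T v x q = 0 ∧ T v y q = -1 := by
  obtain ⟨v, w, x, y, hvw, hxy, hwx, hwy, hli⟩ := hT.exists_normalized_pencil hdim hk
  obtain ⟨p, q, hp1, hp2, hq1, hq2⟩ := exists_dual_pair hli
  have hvw' : ∀ s t : ℝ, s • v + t • w = 0 → s = 0 ∧ t = 0 := by
    intro s t hst
    apply hli
    rw [← hwx]
    simpa using congrArg (fun u => T u x) hst
  have hvxw : T v x w = 0 := by rw [hT.2, hvw]; simp
  have hvyw : T v y w = 0 := by rw [hT.2, hvw]; simp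
  have hvxy : T v x y = 0 := by rw [hT.rotate, hxy]; simp
  have hvyx : T v y x = 0 := by rw [hT.2, hvxy]; simp
  obtain ⟨A, hA⟩ : ∃ A, A = T p q v := ⟨_, rfl⟩
  obtain ⟨B, hB⟩ : ∃ B, B = T p q w := ⟨_, rfl⟩
  obtain ⟨C, hC⟩ : ∃ C, C = T p q x := ⟨_, rfl⟩
  obtain ⟨D, hD⟩ : ∃ D, D = T p q y := ⟨_, rfl⟩
  obtain ⟨p', hp'⟩ : ∃ p', p' = p + D • v + C • w - B • x - A • y := ⟨_, rfl⟩
  have hxp' : T v x p' = 1 := by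
    simp [hp', hp1, hT.self_outer, hT.self_right, hvxw, hvxy]
  have hyp' : T v y p' = 0 := by
    simp [hp', hp2, hT.self_outer, hT.self_right, hvyw, hvyx]
  obtain ⟨b, hb⟩ := hT.exists_basis (q := -q) hdim hvw' hvw hxy hxp' hyp' (by simp [hq1])
    (by simp [hq2])
  refine ⟨v, w, x, y, p', -q, b, hb, hvw, hxy, ?_, hwx, hwy, hxp', hyp', by simp [hq1],
    by simp [hq2]⟩
  have h : T p' q = 0 := by
    refine b.ext fun i => ?_
    have hqp : T p' q p' = 0 := hT.self_outer _ _
    rw [hb]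
    fin_cases i
    · simp [hp', ← hA, hT.rotate x q v, hT.rotate y q v, hT.rotate q v x, hT.rotate q v y, hq1, hq2,
        hT.self_outer, hT.rotate w q v, hT.rotate q v w, hvw]
    · simp [hp', ← hB, hT.rotate x q w, hT.rotate y q w, hT.rotate q w x, hT.rotate q w y, hq1, hq2,
        hT.self_outer, hT.rotate v q w, hT.rotate q w v, hT.swap_eq_zero hvw, hwx, hwy]
    · simp [hp', ← hC, hT.2 v q x, hT.2 w q x, hT.2 y q x, hT.swap_eq_zero hxy, hq1, hq2,
        hT.self_outer, hwx]
    · simp [hp', ← hD, hT.2 v q y, hT.2 w q y, hT.2 x q y, hxy, hq1, hq2, hT.self_outer, hwy]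
    · simpa using hqp
    · simp [hT.self_right]
  rw [map_neg, h, neg_zero]

theorem exists_adjoint_complexStructure (hT : IsAntisymm3 T) [FiniteDimensional ℝ V]
    (hdim : Module.finrank ℝ V = 6)
    (hk : ∀ v ≠ 0, Module.finrank ℝ (LinearMap.ker (T v)) = 2) :
    ∃ J : V →ₗ[ℝ] V, (∀ a, J (J a) = -a) ∧ ∀ a b, T (J a) b = T a (J b) := by
  obtain ⟨v, w, x, y, p, q, b, hb, hvw, hxy, hpq, hwx, hwy, hxp, hyp, hxq, hyq⟩ :=
    hT.exists_normal_basis hdim hk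
  have hwv := hT.swap_eq_zero hvw
  have hyx := hT.swap_eq_zero hxy
  have hqp := hT.swap_eq_zero hpq
  have hxw : T x w = -T v y := by rw [hT.1, hwx]
  have hyw : T y w = T v x := by rw [hT.1, hwy, neg_neg]
  have hxv := hT.1 x v
  have hyv := hT.1 y v
  have hv : ∀ c d, T c d v = T v c d := fun c d => (hT.rotate v c d).symm
  have hw : ∀ c d, T c d w = T w c d := fun c d => (hT.rotate w c d).symm
  have hx : ∀ c, T v c x = - T v x c := fun c => hT.2 _ _ _
  have hy : ∀ c, T v c y = - T v y c := fun c => hT.2 _ _ _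
  have hx' : ∀ c, T w c x = - T v y c := fun c => by rw [hT.2, hwx]
  have hy' : ∀ c, T w c y = T v x c := fun c => by rw [hT.2, hwy]; simp
  have hxy' : ∀ c, T x c y = 0 := fun c => by rw [hT.2, hxy]; simp
  have hyx' : ∀ c, T y c x = 0 := fun c => by rw [hT.2, hyx]; simp
  have hpq' : ∀ c, T c p q = 0 := fun c => by rw [hT.rotate, hpq]; simp
  have hqp' : ∀ c, T c q p = 0 := fun c => by rw [hT.rotate, hqp]; simp
  have e1 : T w p = T v q := by
    refine b.ext fun i => ?_
    rw [hb]
    fin_cases i <;> simp [*, hT.self_outer, hT.self_right]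
  have e2 : T w q = -T v p := by
    refine b.ext fun i => ?_
    rw [hb]
    fin_cases i <;> simp [*, hT.self_outer, hT.self_right]
  have e3 : T y p = T x q := by
    refine b.ext fun i => ?_
    rw [hb]
    fin_cases i <;> simp [*, hT.self_outer, hT.self_right]
  have e4 : T y q = -T x p := by
    refine b.ext fun i => ?_
    rw [hb]
    fin_cases i <;> simp [*, hT.self_outer, hT.self_right]
  obtain ⟨J, hJ⟩ : ∃ J : V →ₗ[ℝ] V, J = b.constr ℝ ![w, -v, y, -x, q, -p] := ⟨_, rfl⟩
  have hJb : ∀ i, J (![v, w, x, y, p, q] i) = ![w, -v, y, -x, q, -p] i := by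
    intro i
    rw [← hb, hJ, b.constr_basis]
  have hJv : J v = w := hJb 0
  have hJw : J w = -v := hJb 1
  have hJx : J x = y := hJb 2
  have hJy : J y = -x := hJb 3
  have hJp : J p = q := hJb 4
  have hJq : J q = -p := hJb 5
  clear hJ hJb
  refine ⟨J, fun a => ?_, fun a c => ?_⟩
  · have h : J ∘ₗ J = -LinearMap.id := by
      refine b.ext fun i => ?_
      rw [hb]
      fin_cases i <;> simp [hJv, hJw, hJx, hJy, hJp, hJq]
    exact congrArg (fun f => f a) h
  · have h : T ∘ₗ J = (LinearMap.lcomp ℝ (V →ₗ[ℝ] ℝ) J) ∘ₗ T := by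
      refine b.ext fun i => b.ext fun j => ?_
      rw [hb]
      fin_cases i <;> fin_cases j <;>
        simp [hJv, hJw, hJx, hJy, hJp, hJq, hT.self, hvw, hwv, hxy, hyx, hpq, hqp, hwx, hwy, hxw,
          hyw, hxv, hyv, e1, e2, e3, e4, hT.1 p, hT.1 q]
    exact congrArg (fun f => f a c) h

/-- Linear maps that can be moved between the arguments of `T` commute. -/
theorem commute_of_adjoint (hT : IsAntisymm3 T) [FiniteDimensional ℝ V]
    (hdim : Module.finrank ℝ V = 6)
    (hk : ∀ v ≠ 0, Module.finrank ℝ (LinearMap.ker (T v)) = 2)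
    {J K : V →ₗ[ℝ] V} (hJ : ∀ a b, T (J a) b = T a (J b)) (hK : ∀ a b, T (K a) b = T a (K b))
    (a : V) : J (K a) = K (J a) := by
  have right : ∀ {L : V →ₗ[ℝ] V}, (∀ a b, T (L a) b = T a (L b)) →
      ∀ a b c, T a (L b) c = T a b (L c) := by
    intro L hL a b c
    rw [hT.rotate, hL, ← hT.rotate]
  rw [← sub_eq_zero]
  by_contra h
  obtain ⟨x, hx⟩ := exists_ne_zero hdim hk h
  apply hx
  ext c
  rw [map_sub, LinearMap.sub_apply, LinearMap.sub_apply, LinearMap.zero_apply, sub_eq_zero, hJ,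
    right hJ, hK, ← right hJ, ← hJ, ← hK]

theorem adjoint_complexStructure_unique (hT : IsAntisymm3 T) [FiniteDimensional ℝ V]
    (hdim : Module.finrank ℝ V = 6)
    (hk : ∀ v ≠ 0, Module.finrank ℝ (LinearMap.ker (T v)) = 2)
    {J K : V →ₗ[ℝ] V} (hJ2 : ∀ a, J (J a) = -a) (hJ : ∀ a b, T (J a) b = T a (J b))
    (hK2 : ∀ a, K (K a) = -a) (hK : ∀ a b, T (K a) b = T a (K b)) : K = J ∨ K = -J := by
  have hc := hT.commute_of_adjoint hdim hk hJ hK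
  by_contra! hne
  obtain ⟨a, ha⟩ : ∃ a, K a - J a ≠ 0 := by
    by_contra! h
    exact hne.1 (LinearMap.ext fun a => sub_eq_zero.1 (h a))
  obtain ⟨a', ha'⟩ : ∃ a, K a + J a ≠ 0 := by
    by_contra! h
    exact hne.2 (LinearMap.ext fun a => eq_neg_of_add_eq_zero_left (h a))
  have hzero : ∀ a b, T (K a - J a) (K b + J b) = 0 := by
    intro a b
    simp only [map_sub, map_add, LinearMap.sub_apply, hJ, hK, hJ2, hK2, hc]
    simp only [map_neg]
    abel
  have hzero' : ∀ a b, T (K a + J a) (K b - J b) = 0 := fun a b => hT.swap_eq_zero (hzero b a)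
  obtain ⟨z, hz⟩ := exists_ne_zero hdim hk ha
  apply hz
  have h1 : T (K a - J a) (K (K z) - J (K z)) = 0 := hT.trans hk ha' (hzero a a') (hzero' a' (K z))
  have h2 : (2 : ℝ) • T (K a - J a) z = 0 := by
    have h := congrArg₂ (· + ·) h1 (hzero a (K z))
    simp only [← map_add, hK2, add_zero] at h
    rw [← neg_eq_zero, ← h, ← map_smul, ← map_neg]
    congr 1
    module
  simpa using h2

end IsAntisymm3

end TrilinearForm

/-- a definite 3-form on a 6-dimensional real vector space admits a
compatible complex structure, and exactly two of them, namely `J` and `-J`. -/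
theorem exists_unique_up_to_sign_compatible_complex_structure
    {V : Type*} [AddCommGroup V] [Module ℝ V] [FiniteDimensional ℝ V]
    (hdim : Module.finrank ℝ V = 6)
    (ρ : V [⋀^Fin 3]→ₗ[ℝ] ℝ) (hρ : IsDefinite3Form ρ) :
    ∃ J : V →ₗ[ℝ] V, IsCompatibleComplexStructure ρ J ∧
      ∀ J' : V →ₗ[ℝ] V, IsCompatibleComplexStructure ρ J' → J' = J ∨ J' = -J := by
  have hT := ρ.isAntisymm3_toTrilinear
  have hk : ∀ v ≠ 0, Module.finrank ℝ (LinearMap.ker (ρ.toTrilinear v)) = 2 := by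
    intro v hv
    have h := (contraction3 ρ v).finrank_range_add_finrank_ker
    rw [hρ v hv, hdim] at h
    rw [ker_toTrilinear]
    omega
  obtain ⟨J, hJ2, hJ⟩ := hT.exists_adjoint_complexStructure hdim hk
  refine ⟨J, ⟨LinearMap.ext hJ2, fun x y z => ?_⟩, fun J' ⟨hJ'2, hJ'⟩ => ?_⟩
  · simp only [← ρ.toTrilinear_apply, hJ, hJ2]
    simp
  · have hJ'2' : ∀ a, J' (J' a) = -a := fun a => congrArg (fun f => f a) hJ'2
    refine hT.adjoint_complexStructure_unique hdim hk hJ2 hJ hJ'2' fun a b => ?_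
    ext c
    have h := hJ' a (J' b) c
    simp only [← ρ.toTrilinear_apply, hJ'2', map_neg, LinearMap.neg_apply, neg_inj] at h
    exact h
end

section
/- The definite 3-forms on a 6-dimensional real vector space form a single orbit of the general linear group: if ρ is a definite 3-form on a 6-dimensional real vector space V, then there exists an ℝ-linear isomorphism g : V → ℂ³ such that ρ(x,y,z) = ρ₀(g x, g y, g z) for all x,y,z ∈ V. -/
/-- The complex determinant of three vectors in `ℂ³`, as an `ℝ`-alternating map. -/
noncomputable def cDet : (Fin 3 → ℂ) [⋀^Fin 3]→ₗ[ℝ] ℂ :=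
  { toMultilinearMap :=
      MultilinearMap.restrictScalars ℝ
        (Matrix.detRowAlternating (R := ℂ) (n := Fin 3)).toMultilinearMap
    map_eq_zero_of_eq' := fun v _ _ hv hij =>
      (Matrix.detRowAlternating (R := ℂ) (n := Fin 3)).map_eq_zero_of_eq v hv hij }

/-- The standard model 3-form `ρ₀ = Re (dz₁ ∧ dz₂ ∧ dz₃)` on `ℂ³`. -/
noncomputable def rhoZero : (Fin 3 → ℂ) [⋀^Fin 3]→ₗ[ℝ] ℝ :=
  Complex.reLm.compAlternatingMap cDet

namespace AlternatingMap

section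

variable {R M N : Type*} [CommRing R] [AddCommGroup M] [Module R M] [AddCommGroup N] [Module R N]
  (f : M [⋀^Fin 3]→ₗ[R] N)

theorem map_vec3_swap_left (x y z : M) : f ![y, x, z] = -f ![x, y, z] := by
  rw [← f.map_swap ![x, y, z] (show (0 : Fin 3) ≠ 1 by decide)]
  congr 1
  ext i
  fin_cases i <;> rfl

theorem map_vec3_swap_right (x y z : M) : f ![x, z, y] = -f ![x, y, z] := by
  rw [← f.map_swap ![x, y, z] (show (1 : Fin 3) ≠ 2 by decide)]
  congr 1
  ext i
  fin_cases i <;> rfl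

/-- An alternating map in three variables, as a curried trilinear map. -/
def toTrilinear_s2 : M →ₗ[R] M →ₗ[R] M →ₗ[R] N :=
  have add₁ (x x₂ y z : M) : f ![x + x₂, y, z] = f ![x, y, z] + f ![x₂, y, z] :=
    f.map_vecCons_add ![y, z] x x₂
  have smul₁ (c : R) (x y z : M) : f ![c • x, y, z] = c • f ![x, y, z] :=
    f.map_vecCons_smul ![y, z] c x
  have add₂ (x y y₂ z : M) : f ![x, y + y₂, z] = f ![x, y, z] + f ![x, y₂, z] := by
    rw [f.map_vec3_swap_left, add₁, neg_add, ← f.map_vec3_swap_left, ← f.map_vec3_swap_left]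
  have smul₂ (c : R) (x y z : M) : f ![x, c • y, z] = c • f ![x, y, z] := by
    rw [f.map_vec3_swap_left, smul₁, ← smul_neg, ← f.map_vec3_swap_left]
  LinearMap.mk₂ R
    (fun x y =>
      { toFun := fun z => f ![x, y, z]
        map_add' := fun z z₂ => by
          rw [f.map_vec3_swap_right, add₂, neg_add, ← f.map_vec3_swap_right,
            ← f.map_vec3_swap_right]
        map_smul' := fun c z => by
          rw [f.map_vec3_swap_right, smul₂, ← smul_neg, ← f.map_vec3_swap_right,
            RingHom.id_apply] })
    (fun x x₂ y => LinearMap.ext fun z => add₁ x x₂ y z)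
    (fun c x y => LinearMap.ext fun z => smul₁ c x y z)
    (fun x y y₂ => LinearMap.ext fun z => add₂ x y y₂ z)
    (fun c x y => LinearMap.ext fun z => smul₂ c x y z)

@[simp]
theorem toTrilinear_apply_s2 (x y z : M) : f.toTrilinear_s2 x y z = f ![x, y, z] := rfl

theorem toTrilinear_swap_left (x y z : M) :
    f.toTrilinear_s2 y x z = -f.toTrilinear_s2 x y z := f.map_vec3_swap_left x y z

theorem toTrilinear_swap_right (x y z : M) :
    f.toTrilinear_s2 x z y = -f.toTrilinear_s2 x y z := f.map_vec3_swap_right x y z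

theorem toTrilinear_left_eq (x z : M) : f.toTrilinear_s2 x x z = 0 :=
  f.map_eq_zero_of_eq ![x, x, z] (i := 0) (j := 1) rfl (by decide)

theorem toTrilinear_right_eq (x y : M) : f.toTrilinear_s2 x y y = 0 :=
  f.map_eq_zero_of_eq ![x, y, y] (i := 1) (j := 2) rfl (by decide)

/-- An alternating map in three variables vanishing on increasing triples of basis vectors
is zero. -/
theorem eq_zero_of_basis_of_lt {ι : Type*} [LinearOrder ι] (b : Module.Basis ι R M)
    (h : ∀ i j k, i < j → j < k → f ![b i, b j, b k] = 0) : f = 0 := by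
  refine b.ext_alternating fun v hv => ?_
  have h_eq : (fun i => b (v i)) = ![b (v 0), b (v 1), b (v 2)] := by
    ext i
    fin_cases i <;> rfl
  rw [h_eq, zero_apply]
  have h01 : v 0 ≠ v 1 := hv.ne (by decide)
  have h12 : v 1 ≠ v 2 := hv.ne (by decide)
  have h02 : v 0 ≠ v 2 := hv.ne (by decide)
  generalize v 0 = i at *
  generalize v 1 = j at *
  generalize v 2 = k at *
  have swap_left := f.map_vec3_swap_left
  have swap_right := f.map_vec3_swap_right
  rcases h01.lt_or_gt with h1 | h1 <;> rcases h12.lt_or_gt with h2 | h2 <;>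
    rcases h02.lt_or_gt with h3 | h3
  · exact h _ _ _ h1 h2
  · exact absurd (h1.trans h2) h3.not_gt
  · rw [swap_right, h _ _ _ h3 h2, neg_zero]
  · rw [swap_right, swap_left, h _ _ _ h3 h1, neg_zero, neg_zero]
  · rw [swap_left, h _ _ _ h1 h3, neg_zero]
  · rw [swap_left, swap_right, h _ _ _ h2 h3, neg_zero, neg_zero]
  · exact absurd (h2.trans h1) h3.not_gt
  · rw [swap_left, swap_right, swap_left, h _ _ _ h2 h1, neg_zero, neg_zero, neg_zero]

end

end AlternatingMap

section Pencil

variable {W : Type*} [AddCommGroup W] [Module ℝ W]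

/-- In a symplectic space of dimension four, the first three iterates of a vector under a
self-adjoint operator are linearly dependent. -/
theorem LinearMap.IsAlt.not_linearIndependent_iterates [FiniteDimensional ℝ W]
    (hW : Module.finrank ℝ W = 4)
    {ω : LinearMap.BilinForm ℝ W} (hω : ω.IsAlt) (hnd : ω.Nondegenerate) {A : W →ₗ[ℝ] W}
    (hA : ∀ x y, ω (A x) y = ω x (A y)) (x : W) :
    ¬ LinearIndependent ℝ ![x, A x, A (A x)] := by
  intro hli
  have h01 : ∀ u, ω u (A u) = 0 := fun u => by
    have h1 := hA u u
    have h2 := LinearMap.IsAlt.neg hω u (A u)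
    linarith
  have h10 : ∀ u, ω (A u) u = 0 := fun u => by rw [hA, h01]
  have h02 : ω x (A (A x)) = 0 := by rw [← hA, hω]
  have h20 : ω (A (A x)) x = 0 := by rw [hA, hω]
  set S := Submodule.span ℝ (Set.range ![x, A x, A (A x)]) with hS
  have hle : S ≤ ω.orthogonal S := by
    rw [hS, Submodule.span_le]
    rintro _ ⟨j, rfl⟩
    rw [SetLike.mem_coe, LinearMap.BilinForm.mem_orthogonal_iff]
    intro n hn
    change ω n _ = 0
    induction hn using Submodule.span_induction with
    | mem n hn =>
      obtain ⟨i, rfl⟩ := hn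
      fin_cases i <;> fin_cases j <;> simp [h01, h10, h02, h20, hω.self_eq_zero]
    | zero => simp
    | add a b _ _ ha hb => simp [ha, hb]
    | smul c a _ ha => simp [ha]
  have h3 : Module.finrank ℝ S = 3 := by
    rw [hS, finrank_span_eq_card hli, Fintype.card_fin]
  have h4 := LinearMap.BilinForm.finrank_orthogonal hnd S
  have h5 := Submodule.finrank_mono hle
  omega

/-- An operator on a real vector space without real eigenvalues, one of whose vectors spans
together with its image an invariant plane, acts on that vector like a complex structure, up to
translation and scaling. -/
theorem exists_complex_structure_of_iterates {A : W →ₗ[ℝ] W}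
    (hA : ∀ (t : ℝ) (u : W), A u = t • u → u = 0) {x : W}
    (hx : x ≠ 0) (hdep : ¬ LinearIndependent ℝ ![x, A x, A (A x)]) :
    ∃ r d : ℝ, d ≠ 0 ∧
      d⁻¹ • (A (d⁻¹ • (A x + r • x)) + r • d⁻¹ • (A x + r • x)) = -x := by
  have hli : LinearIndependent ℝ ![x, A x] := by
    rw [LinearIndependent.pair_iff' hx]
    exact fun t ht => hx (hA t x ht.symm)
  obtain ⟨p, q, hpq⟩ : ∃ p q : ℝ, A (A x) = p • x + q • A x := by
    by_contra! hne
    refine hdep ?_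
    have : ![x, A x, A (A x)] = Fin.snoc (α := fun _ => W) ![x, A x] (A (A x)) := by
      ext i
      fin_cases i <;> rfl
    rw [this, linearIndependent_finSnoc]
    refine ⟨hli, fun hmem => ?_⟩
    simp only [Matrix.range_cons, Matrix.range_empty, Set.union_empty, Set.singleton_union,
      Submodule.mem_span_pair] at hmem
    obtain ⟨p, q, h⟩ := hmem
    exact hne p q h.symm
  have hdisc : 0 < -p - q ^ 2 / 4 := by
    by_contra! hneg
    set s := √(p + q ^ 2 / 4) with hs
    have hs2 : s ^ 2 = p + q ^ 2 / 4 := Real.sq_sqrt (by linarith)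
    have h1 : A (A x - (q / 2 - s) • x) = (q / 2 + s) • (A x - (q / 2 - s) • x) := by
      rw [map_sub, map_smul, hpq]
      have : p = s ^ 2 - q ^ 2 / 4 := by linarith
      rw [this]
      module
    exact hx (hA _ x (sub_eq_zero.mp (hA _ _ h1)))
  set d := √(-p - q ^ 2 / 4) with hd
  have hd0 : d ≠ 0 := (Real.sqrt_pos.mpr hdisc).ne'
  have hd2 : d ^ 2 = -p - q ^ 2 / 4 := Real.sq_sqrt hdisc.le
  refine ⟨-q / 2, d, hd0, ?_⟩
  have hp : p = -d ^ 2 - q ^ 2 / 4 := by linarith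
  rw [map_smul, map_add, map_smul, hpq, hp]
  match_scalars <;> field_simp <;> ring

/-- The two bilinear forms take on pairs of the given vectors the values of the real part and of
the opposite of the imaginary part of `dz₁ ∧ dz₂` on the vectors `e₁, i e₁, e₂, i e₂` of `ℂ²`. -/
structure IsComplexSymplecticFrame (ω₁ ω₂ : LinearMap.BilinForm ℝ W) (x ix y iy : W) : Prop where
  fst_x_ix : ω₁ x ix = 0
  fst_y_iy : ω₁ y iy = 0
  fst_x_y : ω₁ x y = 1
  fst_x_iy : ω₁ x iy = 0
  fst_ix_y : ω₁ ix y = 0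
  fst_ix_iy : ω₁ ix iy = -1
  snd_x_ix : ω₂ x ix = 0
  snd_y_iy : ω₂ y iy = 0
  snd_x_y : ω₂ x y = 0
  snd_x_iy : ω₂ x iy = -1
  snd_ix_y : ω₂ ix y = -1
  snd_ix_iy : ω₂ ix iy = 0

/-- Normal form of a pencil of 2-forms on a four-dimensional real space all of whose nonzero
members are nondegenerate. -/
theorem exists_isComplexSymplecticFrame [FiniteDimensional ℝ W] (hW : Module.finrank ℝ W = 4)
    {ω₁ ω₂ : LinearMap.BilinForm ℝ W} (h₁ : ω₁.IsAlt) (h₂ : ω₂.IsAlt)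
    (hnd : ∀ s t : ℝ, (s ≠ 0 ∨ t ≠ 0) → ∀ x : W, (∀ y, s * ω₁ x y + t * ω₂ x y = 0) → x = 0) :
    ∃ r d : ℝ, d ≠ 0 ∧ ∃ x ix y iy : W,
      IsComplexSymplecticFrame ω₁ (d⁻¹ • (ω₂ + r • ω₁)) x ix y iy := by
  have hnd₁ : ω₁.Nondegenerate := by
    refine (LinearMap.IsRefl.nondegenerate_iff_separatingLeft h₁.isRefl).mpr fun x hx => ?_
    exact hnd 1 0 (by simp) x fun y => by simp [hx y]
  have skew₁ (u v : W) : ω₁ u v = -ω₁ v u := (LinearMap.IsAlt.neg h₁ v u).symm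
  have skew₂ (u v : W) : ω₂ u v = -ω₂ v u := (LinearMap.IsAlt.neg h₂ v u).symm
  set A : W →ₗ[ℝ] W := (ω₁.toDual hnd₁).symm.toLinearMap ∘ₗ ω₂ with hAdef
  have hAω (u v : W) : ω₁ (A u) v = ω₂ u v := by
    rw [← LinearMap.BilinForm.toDual_def hnd₁, hAdef]
    simp
  have hA (u v : W) : ω₁ (A u) v = ω₁ u (A v) := by
    rw [skew₁ u, hAω, hAω, skew₂]
  have heig (t : ℝ) (u : W) (hu : A u = t • u) : u = 0 := by
    refine hnd (-t) 1 (by simp) u fun v => ?_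
    rw [← hAω, hu]
    simp
  have : Nontrivial W := Module.nontrivial_of_finrank_pos (R := ℝ) (by omega)
  obtain ⟨x, hx⟩ := exists_ne (0 : W)
  obtain ⟨r, d, hd, hJx⟩ := exists_complex_structure_of_iterates heig hx
    (LinearMap.IsAlt.not_linearIndependent_iterates hW h₁ hnd₁ hA x)
  set J : W →ₗ[ℝ] W := d⁻¹ • (A + r • LinearMap.id) with hJdef
  have hJJx : J (J x) = -x := by simpa [hJdef] using hJx
  have hJω (u v : W) : (d⁻¹ • (ω₂ + r • ω₁)) u v = ω₁ (J u) v := by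
    simp [hJdef, hAω]
  have hJ (u v : W) : ω₁ (J u) v = ω₁ u (J v) := by
    simp [hJdef, hA]
  have hisoJ (u : W) : ω₁ u (J u) = 0 := by
    have h1 := hJ u u
    have h2 := skew₁ u (J u)
    linarith
  have hself (u : W) : ω₁ u u = 0 := h₁ u
  have hJli : LinearIndependent ℝ ![J x, x] := by
    rw [LinearIndependent.pair_symm_iff, LinearIndependent.pair_iff' hx]
    refine fun t ht => hx (heig (d * t - r) x ?_)
    have : A x = d • J x - r • x := by simp [hJdef, hd]
    rw [this, ← ht]
    module
  obtain ⟨y, hxy, hJxy⟩ : ∃ y, ω₁ x y = 1 ∧ ω₁ (J x) y = 0 := by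
    have hmem : x ∉ Submodule.span ℝ {J x} := by
      rw [Submodule.mem_span_singleton]
      have hJx0 : J x ≠ 0 := hJli.ne_zero 0
      simpa [LinearIndependent.pair_iff' hJx0] using hJli
    obtain ⟨f, hfx, hf⟩ := Submodule.exists_dual_map_eq_bot_of_notMem hmem inferInstance
    have hfJx : f (J x) = 0 := by
      rw [← Submodule.mem_bot ℝ, ← hf]
      exact Submodule.mem_map_of_mem (Submodule.mem_span_singleton_self _)
    refine ⟨-(f x)⁻¹ • (ω₁.toDual hnd₁).symm f, ?_, ?_⟩ <;> rw [skew₁] <;> simp [hfx, hfJx]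
  have hJxJy : ω₁ (J x) (J y) = -1 := by rw [← hJ, hJJx, map_neg, LinearMap.neg_apply, hxy]
  have hxJy : ω₁ x (J y) = 0 := by rw [← hJ, hJxy]
  have hli : LinearIndependent ℝ ![x, J x, y, J y] := by
    rw [Fintype.linearIndependent_iff]
    intro c hc
    simp only [Fin.sum_univ_four, Matrix.cons_val] at hc
    have key (u : W) := congrArg (ω₁ u) hc
    have k0 := key x
    have k1 := key (J x)
    have k2 := key y
    have k3 := key (J y)
    simp only [map_add, map_smul, smul_eq_mul, map_zero, hself, hisoJ, hxy, hJxy, hxJy, hJxJy,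
      skew₁ (J x) x, skew₁ (J y) y, skew₁ y x, skew₁ y (J x), skew₁ (J y) x,
      skew₁ (J y) (J x)] at k0 k1 k2 k3
    intro i
    fin_cases i <;> simp <;> linarith
  have hJJy : J (J y) = -y := by
    let b := basisOfLinearIndependentOfCardEqFinrank hli (by simp [hW])
    have hz : ω₁ (J (J y) + y) = 0 := by
      refine b.ext fun i => ?_
      have hsx : ω₁ (J (J y)) x = -ω₁ y x := by rw [hJ, hJ, hJJx, map_neg]
      have hsJx : ω₁ (J (J y)) (J x) = -ω₁ y (J x) := by rw [hJ, hJ, hJJx, map_neg, map_neg]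
      have hsy : ω₁ (J (J y)) y = 0 := by rw [hJ, hself]
      have hsJy : ω₁ (J (J y)) (J y) = 0 := by rw [skew₁, hisoJ, neg_zero]
      fin_cases i <;> simp [b, hsx, hsJx, hsy, hsJy, hself, hisoJ]
    exact eq_neg_of_add_eq_zero_left (hnd₁.1 _ fun v => by rw [hz, LinearMap.zero_apply])
  refine ⟨r, d, hd, x, J x, y, J y, ?_⟩
  constructor <;>
    simp only [hJω, hself, hisoJ, hxy, hJxy, hxJy, hJxJy, hJJx, map_neg, LinearMap.neg_apply,
      neg_zero]

end Pencil

section DefiniteForm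

variable {V : Type*} [AddCommGroup V] [Module ℝ V]

theorem ker_contraction3 (ρ : V [⋀^Fin 3]→ₗ[ℝ] ℝ) (v : V) :
    LinearMap.ker (contraction3 ρ v) = LinearMap.ker (ρ.toTrilinear_s2 v) := by
  ext x
  rw [LinearMap.mem_ker, LinearMap.mem_ker]
  have h (m : Fin 1 → V) : contraction3 ρ v x m = ρ.toTrilinear_s2 v x (m 0) := by
    have hm : m = ![m 0] := funext fun i => by rw [Subsingleton.elim i 0, Matrix.cons_val_zero]
    generalize m 0 = z at hm
    rw [hm]
    rfl
  constructor
  · intro hx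
    ext z
    have hz := h ![z]
    rw [hx] at hz
    exact hz.symm
  · intro hx
    ext m
    rw [h, hx]
    rfl

variable [FiniteDimensional ℝ V]

theorem IsDefinite3Form.finrank_ker (hdim : Module.finrank ℝ V = 6) {ρ : V [⋀^Fin 3]→ₗ[ℝ] ℝ}
    (hρ : IsDefinite3Form ρ) {v : V} (hv : v ≠ 0) :
    Module.finrank ℝ (LinearMap.ker (ρ.toTrilinear_s2 v)) = 2 := by
  have h := LinearMap.finrank_range_add_finrank_ker (contraction3 ρ v)
  rw [hρ v hv, hdim, ker_contraction3] at h
  omega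

/-- A definite 3-form has a plane that is the kernel of the contraction with each of its nonzero
vectors. -/
theorem IsDefinite3Form.exists_plane (hdim : Module.finrank ℝ V = 6) {ρ : V [⋀^Fin 3]→ₗ[ℝ] ℝ}
    (hρ : IsDefinite3Form ρ) :
    ∃ v w : V, Module.finrank ℝ (Submodule.span ℝ {v, w}) = 2 ∧ ∀ s t : ℝ, s ≠ 0 ∨ t ≠ 0 →
      LinearMap.ker (ρ.toTrilinear_s2 (s • v + t • w)) = Submodule.span ℝ {v, w} := by
  have : Nontrivial V := Module.nontrivial_of_finrank_pos (R := ℝ) (by omega)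
  obtain ⟨v, hv⟩ := exists_ne (0 : V)
  obtain ⟨w, hw, hvw⟩ : ∃ w ∈ LinearMap.ker (ρ.toTrilinear_s2 v), w ∉ Submodule.span ℝ {v} := by
    by_contra! hle
    have h := Submodule.finrank_mono hle
    rw [hρ.finrank_ker hdim hv, finrank_span_singleton hv] at h
    omega
  have hli : LinearIndependent ℝ ![v, w] := by
    rw [LinearIndependent.pair_iff' hv]
    exact fun a ha => hvw (Submodule.mem_span_singleton.mpr ⟨a, ha⟩)
  have hspan : Module.finrank ℝ (Submodule.span ℝ {v, w}) = 2 := by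
    have := finrank_span_eq_card hli
    rwa [Matrix.range_cons_cons_empty, Fintype.card_fin] at this
  have hw0 (z : V) : ρ.toTrilinear_s2 v w z = 0 := by
    rw [LinearMap.mem_ker.mp hw, LinearMap.zero_apply]
  refine ⟨v, w, hspan, fun s t hst => (Submodule.eq_of_le_of_finrank_eq ?_ ?_).symm⟩
  · rw [Submodule.span_le, Set.pair_subset_iff]
    constructor <;> rw [SetLike.mem_coe, LinearMap.mem_ker] <;> ext z
    · simp only [map_add, map_smul, LinearMap.add_apply, LinearMap.smul_apply,
        ρ.toTrilinear_left_eq, ρ.toTrilinear_swap_left v w, hw0]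
      simp
    · simp only [map_add, map_smul, LinearMap.add_apply, LinearMap.smul_apply,
        ρ.toTrilinear_left_eq, hw0]
      simp
  · rw [hspan, hρ.finrank_ker hdim]
    intro h0
    have := (LinearIndependent.pair_iff.mp hli) s t h0
    tauto

/-- Up to its values on triples from a complement of a distinguished plane, a definite 3-form is
standard in some frame. -/
theorem IsDefinite3Form.exists_partial_frame (hdim : Module.finrank ℝ V = 6)
    {ρ : V [⋀^Fin 3]→ₗ[ℝ] ℝ} (hρ : IsDefinite3Form ρ) :
    ∃ v w a ia b ib : V, (∀ z, ρ.toTrilinear_s2 v w z = 0) ∧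
      IsComplexSymplecticFrame (ρ.toTrilinear_s2 v) (ρ.toTrilinear_s2 w) a ia b ib := by
  obtain ⟨v, w, hK, hker⟩ := hρ.exists_plane hdim
  set T := ρ.toTrilinear_s2 with hT
  set K := Submodule.span ℝ {v, w} with hKdef
  obtain ⟨W, hKW⟩ := K.exists_isCompl
  have hW : Module.finrank ℝ W = 4 := by
    have := Submodule.finrank_add_eq_of_isCompl hKW
    omega
  have hvw (z : V) : T v w z = 0 := by
    have h : w ∈ LinearMap.ker (T ((1 : ℝ) • v + (0 : ℝ) • w)) := by
      rw [hker 1 0 (by simp)]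
      exact Submodule.subset_span (by simp)
    simpa using congrArg (fun f => f z) (LinearMap.mem_ker.mp h)
  obtain ⟨r, d, -, a, ia, b, ib, h⟩ := exists_isComplexSymplecticFrame hW
    (ω₁ := (T v).domRestrict₁₂ W W) (ω₂ := (T w).domRestrict₁₂ W W)
    (fun u => ρ.toTrilinear_right_eq v u) (fun u => ρ.toTrilinear_right_eq w u) (by
      intro s t hst x hx
      have hmem : (x : V) ∈ LinearMap.ker (T (s • v + t • w)) := by
        rw [LinearMap.mem_ker]
        ext z
        obtain ⟨k, hk, y, hy, rfl⟩ := Submodule.mem_sup.mp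
          (hKW.sup_eq_top ▸ Submodule.mem_top : z ∈ K ⊔ W)
        rw [← hker s t hst, LinearMap.mem_ker] at hk
        have h1 : T (s • v + t • w) x k = 0 := by
          rw [hT, ρ.toTrilinear_swap_right, ← hT, hk, LinearMap.zero_apply, neg_zero]
        have h2 := hx ⟨y, hy⟩
        rw [map_add, h1]
        simpa [LinearMap.domRestrict₁₂_apply] using h2
      rw [hker s t hst] at hmem
      exact Subtype.ext ((Submodule.disjoint_def.mp hKW.disjoint) x hmem x.2))
  refine ⟨v, d⁻¹ • (w + r • v), a, ia, b, ib, fun z => ?_, ?_⟩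
  · have hvv : T v v z = 0 := ρ.toTrilinear_left_eq v z
    simp [hvw, hvv]
  · have e (u u₂ : W) : T (d⁻¹ • (w + r • v)) u u₂ =
        (d⁻¹ • ((T w).domRestrict₁₂ W W + r • (T v).domRestrict₁₂ W W)) u u₂ := by
      simp [LinearMap.domRestrict₁₂_apply]
    constructor <;> first | rw [e] | skip
    exacts [h.fst_x_ix, h.fst_y_iy, h.fst_x_y, h.fst_x_iy, h.fst_ix_y, h.fst_ix_iy, h.snd_x_ix,
      h.snd_y_iy, h.snd_x_y, h.snd_x_iy, h.snd_ix_y, h.snd_ix_iy]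

/-- A definite 3-form takes in some frame the values of the model form on
`e₁, i e₁, e₂, i e₂, e₃, i e₃`. -/
theorem IsDefinite3Form.exists_frame (hdim : Module.finrank ℝ V = 6)
    {ρ : V [⋀^Fin 3]→ₗ[ℝ] ℝ} (hρ : IsDefinite3Form ρ) :
    ∃ v w x ix y iy : V, (∀ z, ρ.toTrilinear_s2 v w z = 0) ∧
      IsComplexSymplecticFrame (ρ.toTrilinear_s2 v) (ρ.toTrilinear_s2 w) x ix y iy ∧
      ρ.toTrilinear_s2 x ix y = 0 ∧ ρ.toTrilinear_s2 x ix iy = 0 ∧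
      ρ.toTrilinear_s2 x y iy = 0 ∧ ρ.toTrilinear_s2 ix y iy = 0 := by
  obtain ⟨v, w, a, ia, b, ib, hvw, h⟩ := hρ.exists_partial_frame hdim
  set T := ρ.toTrilinear_s2 with hT
  have swap_left := ρ.toTrilinear_swap_left
  have swap_right := ρ.toTrilinear_swap_right
  rw [← hT] at swap_left swap_right
  have hwv (z : V) : T w v z = 0 := by rw [swap_left, hvw, neg_zero]
  have hvv (z : V) : T v v z = 0 := ρ.toTrilinear_left_eq v z
  have hww (z : V) : T w w z = 0 := ρ.toTrilinear_left_eq w z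
  have hvzv (z : V) : T v z v = 0 := by rw [swap_right, hvv, neg_zero]
  have hvzw (z : V) : T v z w = 0 := by rw [swap_right, hvw, neg_zero]
  have hwzv (z : V) : T w z v = 0 := by rw [swap_right, hwv, neg_zero]
  have hwzw (z : V) : T w z w = 0 := by rw [swap_right, hww, neg_zero]
  obtain ⟨h1, h2, h3, h4, h5, h6, h7, h8, h9, h10, h11, h12⟩ := h
  refine ⟨v, w, a + (T a ia ib • v + T a ia b • w), ia,
    b - (T ia b ib • v + T a b ib • w), ib, hvw, ?_, ?_, ?_, ?_, ?_⟩
  · constructor <;>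
      simp only [map_add, map_sub, map_smul, LinearMap.add_apply, LinearMap.sub_apply,
        LinearMap.smul_apply, hvv, hww, hvw, hwv, hvzv, hvzw, hwzv, hwzw, h1, h2, h3, h4, h5, h6,
        h7, h8, h9, h10, h11, h12, smul_zero, add_zero, sub_zero]
  all_goals
    simp only [map_add, map_sub, map_smul, LinearMap.add_apply, LinearMap.sub_apply,
      LinearMap.smul_apply, hvv, hww, hvw, hwv, hvzv, hvzw, hwzv, hwzw, swap_left v a,
      swap_left w a, swap_left v ia, swap_left w ia, swap_right a v ia, swap_right a w ia,
      h1, h2, h4, h5, h6, h7, h8, h10, h11, h12, smul_eq_mul]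
    ring

/-- The standard real coordinates of `ℂ³`. -/
def complexThreeEquiv : (Fin 6 → ℝ) ≃ₗ[ℝ] (Fin 3 → ℂ) where
  toFun c := ![⟨c 0, c 1⟩, ⟨c 2, c 3⟩, ⟨c 4, c 5⟩]
  invFun z := ![(z 0).re, (z 0).im, (z 1).re, (z 1).im, (z 2).re, (z 2).im]
  map_add' c c₂ := by
    ext i
    fin_cases i <;> rfl
  map_smul' r c := by
    ext i
    fin_cases i <;> simp [Complex.ext_iff]
  left_inv c := by
    ext i
    fin_cases i <;> rfl
  right_inv z := by
    ext i
    fin_cases i <;> rfl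

theorem rhoZero_apply (x y z : Fin 3 → ℂ) :
    rhoZero ![x, y, z] = (x 0 * y 1 * z 2 - x 0 * y 2 * z 1 - x 1 * y 0 * z 2 + x 1 * y 2 * z 0 +
      x 2 * y 0 * z 1 - x 2 * y 1 * z 0).re := by
  change (Matrix.det (Matrix.of ![x, y, z])).re = _
  rw [Matrix.det_fin_three]
  rfl

end DefiniteForm

/-- the definite 3-forms on a 6-dimensional real vector space form a
single `GL(V)`-orbit: every definite 3-form is equivalent to the standard model
`ρ₀` on `ℂ³` under an `ℝ`-linear isomorphism. -/
theorem definite3Form_single_orbit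
    {V : Type*} [AddCommGroup V] [Module ℝ V] [FiniteDimensional ℝ V]
    (hdim : Module.finrank ℝ V = 6)
    (ρ : V [⋀^Fin 3]→ₗ[ℝ] ℝ) (hρ : IsDefinite3Form ρ) :
    ∃ g : V ≃ₗ[ℝ] (Fin 3 → ℂ),
      ∀ x y z : V, ρ ![x, y, z] = rhoZero ![g x, g y, g z] := by
  obtain ⟨v, w, x, ix, y, iy, hvw, ⟨h1, h2, h3, h4, h5, h6, h7, h8, h9, h10, h11, h12⟩,
    h13, h14, h15, h16⟩ := hρ.exists_frame hdim
  have hT : ∀ a b c : V, ρ.toTrilinear_s2 a b c = ρ ![a, b, c] := ρ.toTrilinear_apply_s2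
  have hli : LinearIndependent ℝ (![v, w, x, ix, y, iy] : Fin 6 → V) := by
    rw [Fintype.linearIndependent_iff]
    intro c hc
    simp only [Fin.sum_univ_six, Matrix.cons_val] at hc
    have key (p q : V) := congrArg (fun u => ρ.toTrilinear_s2 u p q) hc
    simp only [map_add, map_smul, LinearMap.add_apply, LinearMap.smul_apply, map_zero,
      LinearMap.zero_apply, smul_eq_mul] at key
    have swap_left := ρ.toTrilinear_swap_left
    have swap_right := ρ.toTrilinear_swap_right
    have left_eq := ρ.toTrilinear_left_eq
    have right_eq := ρ.toTrilinear_right_eq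
    have k0 := key x y
    have k1 := key x iy
    have k2 := key v y
    have k3 := key v iy
    have k4 := key v x
    have k5 := key v ix
    simp only [left_eq, right_eq, hvw, swap_left v w, swap_left v x, swap_left v ix,
      swap_left v y, swap_left v iy, swap_right v x, swap_right v ix y, swap_right v ix iy,
      swap_left x ix, swap_left x y, swap_left x iy, swap_right x y iy, swap_right v y iy,
      h1, h2, h3, h4, h5, h6, h9, h10, h13, h14, h15] at k0 k1 k2 k3 k4 k5
    intro i
    fin_cases i <;> simp <;> linarith
  let b : Module.Basis (Fin 6) ℝ V := basisOfLinearIndependentOfCardEqFinrank hli (by simp [hdim])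
  have hb : ⇑b = ![v, w, x, ix, y, iy] := coe_basisOfLinearIndependentOfCardEqFinrank _ _
  let g : V ≃ₗ[ℝ] (Fin 3 → ℂ) := b.equivFun.trans complexThreeEquiv
  have hg (i : Fin 6) : g (b i) = complexThreeEquiv (Pi.single i 1) := by
    rw [LinearEquiv.trans_apply]
    congr 1
    ext j
    rw [b.equivFun_self, Pi.single_apply]
    simp only [eq_comm]
  have hzero : ρ - rhoZero.compLinearMap g.toLinearMap = 0 := by
    refine AlternatingMap.eq_zero_of_basis_of_lt _ b fun i j k hij hjk => ?_
    have hcomp : rhoZero.compLinearMap g.toLinearMap ![b i, b j, b k] =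
        rhoZero ![g (b i), g (b j), g (b k)] := by
      rw [AlternatingMap.compLinearMap_apply]
      congr 1
      ext l : 1
      fin_cases l <;> rfl
    rw [AlternatingMap.sub_apply, hcomp, sub_eq_zero, hg, hg, hg, rhoZero_apply, hb, ← hT]
    fin_cases i <;> fin_cases j <;> try exact absurd hij (by decide)
    all_goals fin_cases k <;> try exact absurd hjk (by decide)
    all_goals simp [complexThreeEquiv, -AlternatingMap.toTrilinear_apply_s2, *]
  refine ⟨g, fun p q r => ?_⟩
  have h := congrArg (fun f => f ![p, q, r]) hzero
  simp only [AlternatingMap.sub_apply, AlternatingMap.zero_apply, sub_eq_zero] at h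
  rw [h, AlternatingMap.compLinearMap_apply]
  congr 1
  ext l : 1
  fin_cases l <;> rfl
end

section
/- The stabiliser of ρ₀ in the orientation-preserving general linear group is SL(3,ℂ): if g : ℂ³ → ℂ³ is an ℝ-linear automorphism with positive real determinant such that ρ₀(g x, g y, g z) = ρ₀(x,y,z) for all x,y,z, then g is ℂ-linear and its complex determinant equals 1. Conversely, every ℂ-linear automorphism g of ℂ³ with complex determinant 1 has positive real determinant and satisfies ρ₀(g x, g y, g z) = ρ₀(x,y,z) for all x,y,z. -/
open scoped Matrix in
theorem rhoZero_apply_eq_re_dotProduct (x y z : Fin 3 → ℂ) :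
    rhoZero ![x, y, z] = (z ⬝ᵥ x ⨯₃ y).re := by
  rw [triple_product_permutation, triple_product_eq_det]
  rfl

theorem rhoZero_apply_map (f : (Fin 3 → ℂ) →ₗ[ℂ] (Fin 3 → ℂ)) (x y z : Fin 3 → ℂ) :
    rhoZero ![f x, f y, f z] = (LinearMap.det f * Matrix.det ![x, y, z]).re := by
  have h := (Pi.basisFun ℂ (Fin 3)).det_comp f ![x, y, z]
  have hf : f ∘ ![x, y, z] = ![f x, f y, f z] := by
    ext i j
    fin_cases i <;> rfl
  rw [hf, Pi.basisFun_det] at h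
  exact congrArg Complex.re h

open scoped Matrix in
/-- The kernel of the contraction of `ρ₀` with `x` consists of the vectors parallel to `x`. -/
theorem crossProduct_eq_zero_iff_rhoZero (x y : Fin 3 → ℂ) :
    x ⨯₃ y = 0 ↔ ∀ z, rhoZero ![x, y, z] = 0 := by
  simp only [rhoZero_apply_eq_re_dotProduct]
  refine ⟨fun h z => by simp [h], fun h => dotProduct_eq_zero _ fun w => ?_⟩
  rw [dotProduct_comm]
  apply Complex.ext
  · exact h w
  · simpa using h (-Complex.I • w)

open scoped Matrix in
/-- A real-linear endomorphism of `ℂ³` preserving every complex line is a complex scalar. -/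
theorem exists_eq_smul_of_crossProduct_eq_zero (J : (Fin 3 → ℂ) →ₗ[ℝ] (Fin 3 → ℂ))
    (hJ : ∀ u, u ⨯₃ J u = 0) : ∃ c : ℂ, ∀ u, J u = c • u := by
  have parallel : ∀ u i j, u i * J u j = u j * J u i := by
    intro u i j
    have h := hJ u
    rw [cross_apply] at h
    have h0 := congrFun h 0
    have h1 := congrFun h 1
    have h2 := congrFun h 2
    simp at h0 h1 h2
    fin_cases i <;> fin_cases j <;> simp <;> grind
  have off_diag : ∀ i j a, i ≠ j → J (Pi.single i a) j = 0 := by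
    intro i j a hij
    rcases eq_or_ne a 0 with rfl | ha
    · simp
    · have h := parallel (Pi.single i a) i j
      simpa [hij.symm, ha] using h
  have diag : ∀ i j a b, i ≠ j →
      a * J (Pi.single j b) j = b * J (Pi.single i a) i := by
    intro i j a b hij
    have h := parallel (Pi.single i a + Pi.single j b) i j
    simpa [hij, hij.symm, off_diag i j a hij, off_diag j i b hij.symm] using h
  refine ⟨J (Pi.single 0 1) 0, fun u => ?_⟩
  have hdiag : ∀ i a, J (Pi.single i a) i = J (Pi.single 0 1) 0 * a := by
    have h1 : ∀ j a, (0 : Fin 3) ≠ j → J (Pi.single j a) j = J (Pi.single 0 1) 0 * a := by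
      intro j a hj
      linear_combination diag 0 j 1 a hj
    intro i a
    rcases eq_or_ne 0 i with rfl | hi
    · linear_combination diag 1 0 1 a (by decide) + a * h1 1 1 (by decide)
    · exact h1 i a hi
  conv_lhs => rw [← Finset.univ_sum_single u, map_sum]
  ext j
  rw [Finset.sum_apply, Finset.sum_eq_single j]
  · simpa using hdiag j (u j)
  · exact fun i _ hij => off_diag i j (u i) hij
  · simp

/-- Coordinatewise complex conjugation on `ℂ³`. -/
noncomputable def piConj : (Fin 3 → ℂ) →ₗ[ℝ] (Fin 3 → ℂ) :=
  LinearMap.pi fun i => Complex.conjAe.toLinearEquiv.toLinearMap.comp (LinearMap.proj i)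

theorem det_piConj : LinearMap.det piConj = -1 := by
  rw [piConj, LinearMap.det_pi]
  simp only [Complex.det_conjAe, Finset.prod_const, Finset.card_univ, Fintype.card_fin]
  norm_num

theorem piConj_smul (c : ℂ) (x : Fin 3 → ℂ) :
    piConj (c • x) = (starRingEnd ℂ) c • piConj x := by
  ext i
  simp [piConj]

/-- The complex-linear map underlying a real-linear map commuting with multiplication by `i`. -/
def complexLinearOfMapISmul {V W : Type*} [AddCommGroup V] [Module ℂ V] [AddCommGroup W]
    [Module ℂ W] (g : V →ₗ[ℝ] W) (hg : ∀ x, g (Complex.I • x) = Complex.I • g x) :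
    V →ₗ[ℂ] W where
  toFun := g
  map_add' := g.map_add
  map_smul' c x := by
    have hr : ∀ (r : ℝ) (y : V), g ((r : ℂ) • y) = (r : ℂ) • g y := fun r y => by
      simp [Complex.coe_smul]
    rw [← Complex.re_add_im c]
    simp only [add_smul, mul_smul, map_add, hr, hg, RingHom.id_apply]

/-- A real-linear automorphism preserving `ρ₀` either commutes or anticommutes with
multiplication by `i`. -/
theorem map_I_smul_of_rhoZero_invariant (g : (Fin 3 → ℂ) →ₗ[ℝ] (Fin 3 → ℂ))
    (hb : Function.Bijective g)
    (hg : ∀ x y z : Fin 3 → ℂ, rhoZero ![g x, g y, g z] = rhoZero ![x, y, z]) :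
    (∀ x, g (Complex.I • x) = Complex.I • g x) ∨
      ∀ x, g (Complex.I • x) = -Complex.I • g x := by
  let e := LinearEquiv.ofBijective g hb
  have he : ∀ x, g (e.symm x) = x := e.apply_symm_apply
  let J : (Fin 3 → ℂ) →ₗ[ℝ] (Fin 3 → ℂ) :=
    g ∘ₗ (Complex.I • LinearMap.id : (Fin 3 → ℂ) →ₗ[ℂ] (Fin 3 → ℂ)).restrictScalars ℝ ∘ₗ
      e.symm.toLinearMap
  obtain ⟨c, hc⟩ := exists_eq_smul_of_crossProduct_eq_zero J fun u => by
    rw [crossProduct_eq_zero_iff_rhoZero]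
    intro z
    have h := hg (e.symm u) (Complex.I • e.symm u) (e.symm z)
    rw [he, he] at h
    refine h.trans ((crossProduct_eq_zero_iff_rhoZero _ _).mp ?_ _)
    rw [map_smul, cross_self, smul_zero]
  have hgc : ∀ x, g (Complex.I • x) = c • g x := fun x => by
    have h := hc (g x)
    have hx : e.symm (g x) = x := e.symm_apply_apply x
    simpa [J, hx] using h
  have hsq : c * c = -1 := by
    have h := hgc (Complex.I • e.symm 1)
    rw [smul_smul, Complex.I_mul_I, neg_one_smul, map_neg, he, hgc, he, smul_smul] at h
    simpa using (congrFun h 0).symm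
  have hfac : (c - Complex.I) * (c + Complex.I) = 0 := by
    linear_combination hsq - Complex.I_mul_I
  rcases mul_eq_zero.mp hfac with h | h
  · left
    rwa [sub_eq_zero.mp h] at hgc
  · right
    rwa [eq_neg_of_add_eq_zero_left h] at hgc

theorem det_eq_one_of_rhoZero_invariant (f : (Fin 3 → ℂ) →ₗ[ℂ] (Fin 3 → ℂ))
    (hf : ∀ x y z : Fin 3 → ℂ, rhoZero ![f x, f y, f z] = rhoZero ![x, y, z]) :
    LinearMap.det f = 1 := by
  have h : ∀ a : ℂ, (LinearMap.det f * a).re = a.re := by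
    intro a
    have ha : Matrix.det (n := Fin 3) ![![a, 0, 0], ![0, 1, 0], ![0, 0, 1]] = a :=
      (Matrix.det_fin_three !![a, 0, 0; 0, 1, 0; 0, 0, 1]).trans (by simp)
    have h := hf ![a, 0, 0] ![0, 1, 0] ![0, 0, 1]
    rw [rhoZero_apply_map, ha] at h
    exact h.trans (congrArg Complex.re ha)
  apply Complex.ext
  · simpa using h 1
  · simpa using h Complex.I

/-- the stabiliser of `ρ₀` in `GL⁺(ℝ⁶)` is `SL(3, ℂ)`.
Forward direction: an `ℝ`-linear automorphism of `ℂ³` with positive real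
determinant preserving `ρ₀` is `ℂ`-linear with complex determinant `1`.
Converse: every `ℂ`-linear automorphism of complex determinant `1` has positive
real determinant and preserves `ρ₀`. -/
theorem stabiliser_of_rhoZero_is_SL3C :
    (∀ g : (Fin 3 → ℂ) →ₗ[ℝ] (Fin 3 → ℂ), Function.Bijective g →
      0 < LinearMap.det g →
      (∀ x y z : Fin 3 → ℂ, rhoZero ![g x, g y, g z] = rhoZero ![x, y, z]) →
      ∃ gc : (Fin 3 → ℂ) →ₗ[ℂ] (Fin 3 → ℂ),
        (∀ x, gc x = g x) ∧ LinearMap.det gc = 1) ∧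
    (∀ gc : (Fin 3 → ℂ) →ₗ[ℂ] (Fin 3 → ℂ), Function.Bijective gc →
      LinearMap.det gc = 1 →
      0 < LinearMap.det (gc.restrictScalars ℝ) ∧
        ∀ x y z : Fin 3 → ℂ, rhoZero ![gc x, gc y, gc z] = rhoZero ![x, y, z]) := by
  refine ⟨fun g hb hpos hg => ?_, fun gc _ hdet => ⟨?_, fun x y z => ?_⟩⟩
  · rcases map_I_smul_of_rhoZero_invariant g hb hg with hI | hI
    · exact ⟨complexLinearOfMapISmul g hI, fun _ => rfl,
        det_eq_one_of_rhoZero_invariant (complexLinearOfMapISmul g hI) hg⟩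
    · have hI' : ∀ x, (g ∘ₗ piConj) (Complex.I • x) = Complex.I • (g ∘ₗ piConj) x := fun x => by
        simp [piConj_smul, hI]
      have hdet : LinearMap.det (g ∘ₗ piConj) = -LinearMap.det g := by
        rw [LinearMap.det_comp, det_piConj, mul_neg_one]
      have hnonneg : 0 ≤ LinearMap.det (g ∘ₗ piConj) := by
        change 0 ≤ LinearMap.det ((complexLinearOfMapISmul _ hI').restrictScalars ℝ)
        rw [LinearMap.det_restrictScalars, Algebra.norm_complex_apply]
        exact Complex.normSq_nonneg _
      linarith
  · rw [LinearMap.det_restrictScalars, hdet, map_one]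
    exact one_pos
  · rw [rhoZero_apply_map, hdet, one_mul]
    rfl
end

section
/- Let ρ be a definite 3-form on a 6-dimensional real vector space V and let J be a complex structure compatible with ρ. Then for every nonzero v ∈ V the null space N_v = {w ∈ V : ρ(v,w,z) = 0 for all z ∈ V} equals the 2-dimensional real span of v and Jv. -/
/-- The kernel of the contraction `i_v ρ` consists of the `w` with `ρ(v, w, ·) = 0`. -/
theorem mem_ker_contraction3 {V : Type*} [AddCommGroup V] [Module ℝ V]
    (ρ : V [⋀^Fin 3]→ₗ[ℝ] ℝ) (v w : V) :
    w ∈ LinearMap.ker (contraction3 ρ v) ↔ ∀ z : V, ρ ![v, w, z] = 0 := by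
  rw [LinearMap.mem_ker]
  refine ⟨fun h z => DFunLike.congr_fun h ![z], fun h => ?_⟩
  ext m
  rw [← FinVec.etaExpand_eq m]
  exact h (m 0)

/-- If `J` is compatible with `ρ`, then `ρ(v, Jv, ·) = 0`. -/
theorem IsCompatibleComplexStructure.apply_self_apply {V : Type*} [AddCommGroup V] [Module ℝ V]
    {ρ : V [⋀^Fin 3]→ₗ[ℝ] ℝ} {J : V →ₗ[ℝ] V} (hJ : IsCompatibleComplexStructure ρ J)
    (v z : V) : ρ ![v, J v, z] = 0 := by
  have hJJ : J (J v) = (-1 : ℝ) • v := by simpa using LinearMap.congr_fun hJ.1 v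
  have h₁ : ρ ![J v, (-1 : ℝ) • v, z] = -ρ ![v, J v, z] := hJJ ▸ hJ.2 v (J v) z
  have h₂ : ρ ![J v, (-1 : ℝ) • v, z] = -ρ ![J v, v, z] := by
    have h := ρ.map_update_smul ![J v, v, z] 1 (-1) v
    rw [show Function.update ![J v, v, z] 1 ((-1 : ℝ) • v) = ![J v, (-1 : ℝ) • v, z] by
        ext i
        fin_cases i <;> rfl,
      Function.update_eq_self_iff.2 (show v = ![J v, v, z] 1 from rfl)] at h
    rw [h, neg_one_smul]
  have h₃ : ρ ![J v, v, z] = -ρ ![v, J v, z] := by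
    rw [← ρ.map_swap ![v, J v, z] (show (0 : Fin 3) ≠ 1 by decide)]
    congr 1
    ext i
    fin_cases i <;> rfl
  linarith

/-- A nonzero vector and its image under a complex structure are linearly independent. -/
theorem linearIndependent_pair_of_comp_self_eq_neg_id {V : Type*} [AddCommGroup V] [Module ℝ V]
    {J : V →ₗ[ℝ] V} (hJ : J ∘ₗ J = -LinearMap.id) {v : V} (hv : v ≠ 0) :
    LinearIndependent ℝ ![v, J v] := by
  have hJJ : J (J v) = -v := by simpa using LinearMap.congr_fun hJ v
  rw [LinearIndependent.pair_iff]
  intro a b h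
  have h' : a • J v - b • v = 0 := by
    simpa [hJJ, sub_eq_add_neg] using congrArg J h
  have hsq : (a * a + b * b) • v = 0 := by
    linear_combination (norm := module) a • h - b • h'
  exact mul_self_add_mul_self_eq_zero.mp ((smul_eq_zero.mp hsq).resolve_right hv)

/-- for a definite 3-form `ρ` with compatible complex structure `J`
and nonzero `v`, the null space `N_v = {w | ρ(v,w,·) = 0}` is the 2-dimensional
real span of `v` and `J v`. -/
theorem nullSpace_eq_span_v_Jv
    {V : Type*} [AddCommGroup V] [Module ℝ V] [FiniteDimensional ℝ V]
    (hdim : Module.finrank ℝ V = 6)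
    (ρ : V [⋀^Fin 3]→ₗ[ℝ] ℝ) (hρ : IsDefinite3Form ρ)
    (J : V →ₗ[ℝ] V) (hJ : IsCompatibleComplexStructure ρ J)
    (v : V) (hv : v ≠ 0) :
    {w : V | ∀ z : V, ρ ![v, w, z] = 0} = (Submodule.span ℝ {v, J v} : Set V) ∧
      Module.finrank ℝ (Submodule.span ℝ {v, J v}) = 2 := by
  have hrank : Module.finrank ℝ (Submodule.span ℝ {v, J v}) = 2 := by
    have h := finrank_span_eq_card (linearIndependent_pair_of_comp_self_eq_neg_id hJ.1 hv)
    rwa [Matrix.range_cons_cons_empty, Fintype.card_fin] at h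
  refine ⟨?_, hrank⟩
  have hle : Submodule.span ℝ {v, J v} ≤ LinearMap.ker (contraction3 ρ v) := by
    rw [Submodule.span_le, Set.pair_subset_iff]
    refine ⟨(mem_ker_contraction3 ρ v v).2 fun z => ?_,
      (mem_ker_contraction3 ρ v (J v)).2 (hJ.apply_self_apply v)⟩
    exact ρ.map_eq_zero_of_eq ![v, v, z] (i := 0) (j := 1) rfl (by decide)
  have hker := (contraction3 ρ v).finrank_range_add_finrank_ker
  rw [hρ v hv, hdim] at hker
  rw [Submodule.eq_of_le_of_finrank_eq hle (by omega)]
  ext w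
  exact (mem_ker_contraction3 ρ v w).symm
end

section
/- Let ρ be a definite 3-form on a 6-dimensional real vector space V and let v ∈ V be nonzero. Then there exists a 4-dimensional subspace Q ⊂ V complementary to the null space N_v (i.e. V = N_v ⊕ Q) on which ρ restricts to zero: ρ(q₁,q₂,q₃) = 0 for all q₁,q₂,q₃ ∈ Q. -/
/-- The null space `N_v = {w | ρ(v, w, z) = 0 for all z}` of the contraction `i_v ρ`. -/
noncomputable def nullSpace {V : Type*} [AddCommGroup V] [Module ℝ V]
    (ρ : V [⋀^Fin 3]→ₗ[ℝ] ℝ) (v : V) : Submodule ℝ V :=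
  LinearMap.ker (contraction3 ρ v)

section TrilinearCalculus

variable {V : Type*} [AddCommGroup V] [Module ℝ V] (ρ : V [⋀^Fin 3]→ₗ[ℝ] ℝ)

theorem threeForm_swap_left (x y z : V) : ρ ![y, x, z] = -ρ ![x, y, z] := by
  have h := ρ.map_swap ![x, y, z] (show (0 : Fin 3) ≠ 1 by decide)
  rw [← h]
  congr 1
  ext i
  fin_cases i <;> rfl

theorem threeForm_swap_right (x y z : V) : ρ ![x, z, y] = -ρ ![x, y, z] := by
  have h := ρ.map_swap ![x, y, z] (show (1 : Fin 3) ≠ 2 by decide)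
  rw [← h]
  congr 1
  ext i
  fin_cases i <;> rfl

theorem threeForm_self_left (x z : V) : ρ ![x, x, z] = 0 := by
  linarith [threeForm_swap_left ρ x x z]

theorem threeForm_self_right (x z : V) : ρ ![x, z, z] = 0 := by
  linarith [threeForm_swap_right ρ x z z]

theorem threeForm_add_smul_left (x x' y z : V) (a : ℝ) :
    ρ ![x + a • x', y, z] = ρ ![x, y, z] + a * ρ ![x', y, z] := by
  have h1 := ρ.map_vecCons_add ![y, z] x (a • x')
  have h2 := ρ.map_vecCons_smul ![y, z] a x'
  rw [h1, h2, smul_eq_mul]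

theorem threeForm_add_smul_mid (x y y' z : V) (a : ℝ) :
    ρ ![x, y + a • y', z] = ρ ![x, y, z] + a * ρ ![x, y', z] := by
  rw [threeForm_swap_left ρ (y + a • y') x z, threeForm_add_smul_left,
    threeForm_swap_left ρ x y z, threeForm_swap_left ρ x y' z]
  ring

theorem threeForm_add_smul_right (x y z z' : V) (a : ℝ) :
    ρ ![x, y, z + a • z'] = ρ ![x, y, z] + a * ρ ![x, y, z'] := by
  rw [threeForm_swap_right ρ x (z + a • z') y, threeForm_add_smul_mid,
    threeForm_swap_right ρ x y z, threeForm_swap_right ρ x y z']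
  ring

theorem mem_nullSpace_iff (v w : V) : w ∈ nullSpace ρ v ↔ ∀ z : V, ρ ![v, w, z] = 0 := by
  rw [nullSpace, LinearMap.mem_ker]
  constructor
  · intro h z
    have := congrArg (fun f : V [⋀^Fin 1]→ₗ[ℝ] ℝ => f ![z]) h
    simpa [contraction3] using this
  · intro h
    ext z
    have hz : z = ![z 0] := by ext i; fin_cases i; rfl
    rw [hz]
    simpa [contraction3] using h (z 0)

/-- A 3-form vanishes on the span of four vectors as soon as it vanishes on the four triples of
distinct vectors among them. -/
theorem threeForm_eq_zero_on_range (u : Fin 4 → V)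
    (h₀ : ρ ![u 1, u 2, u 3] = 0) (h₁ : ρ ![u 0, u 2, u 3] = 0)
    (h₂ : ρ ![u 0, u 1, u 3] = 0) (h₃ : ρ ![u 0, u 1, u 2] = 0)
    {q₁ q₂ q₃ : V} (hq₁ : q₁ ∈ LinearMap.range (Fintype.linearCombination ℝ u))
    (hq₂ : q₂ ∈ LinearMap.range (Fintype.linearCombination ℝ u))
    (hq₃ : q₃ ∈ LinearMap.range (Fintype.linearCombination ℝ u)) :
    ρ ![q₁, q₂, q₃] = 0 := by
  have hbasis : ∀ i j k : Fin 4, ρ ![u i, u j, u k] = 0 := by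
    intro i j k
    have sl := threeForm_swap_left ρ
    have sr := threeForm_swap_right ρ
    have tl := threeForm_self_left ρ
    have tr := threeForm_self_right ρ
    fin_cases i <;> fin_cases j <;> fin_cases k <;>
      simp only [Fin.zero_eta, Fin.mk_one, Fin.reduceFinMk] <;> grind
  have hzero : ρ.compLinearMap (Fintype.linearCombination ℝ u) = 0 := by
    refine Module.Basis.ext_alternating (Pi.basisFun ℝ (Fin 4)) fun s _ => ?_
    have := hbasis (s 0) (s 1) (s 2)
    simp only [AlternatingMap.compLinearMap_apply, AlternatingMap.zero_apply]
    rw [← this]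
    congr 1
    ext i
    fin_cases i <;> simp [Fintype.linearCombination_apply_single]
  obtain ⟨c₁, rfl⟩ := hq₁
  obtain ⟨c₂, rfl⟩ := hq₂
  obtain ⟨c₃, rfl⟩ := hq₃
  have h := congrArg (fun f : (Fin 4 → ℝ) [⋀^Fin 3]→ₗ[ℝ] ℝ => f ![c₁, c₂, c₃]) hzero
  simp only [AlternatingMap.compLinearMap_apply, AlternatingMap.zero_apply] at h
  rw [← h]
  congr 1
  ext i
  fin_cases i <;> rfl

/-- The 2-form `i_v ρ` as a bilinear form. -/
noncomputable def contractionBilin (v : V) : V →ₗ[ℝ] V →ₗ[ℝ] ℝ :=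
  LinearMap.mk₂ ℝ (fun x y => ρ ![v, x, y])
    (fun x x' y => by simpa using threeForm_add_smul_mid ρ v x x' y 1)
    (fun a x y => by
      have h0 := (mem_nullSpace_iff ρ v 0).1 (Submodule.zero_mem _) y
      simpa [h0] using threeForm_add_smul_mid ρ v 0 x y a)
    (fun x y y' => by simpa using threeForm_add_smul_right ρ v x y y' 1)
    (fun a x y => by
      have h0 : ρ ![v, x, 0] = 0 := by
        rw [threeForm_swap_right, (mem_nullSpace_iff ρ v 0).1 (Submodule.zero_mem _), neg_zero]
      simpa [h0] using threeForm_add_smul_right ρ v x 0 y a)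

@[simp]
theorem contractionBilin_apply (v x y : V) : contractionBilin ρ v x y = ρ ![v, x, y] := rfl

theorem exists_pairing_eq_one {v x : V} (hx : x ∉ nullSpace ρ v) : ∃ y, ρ ![v, x, y] = 1 := by
  rw [mem_nullSpace_iff] at hx
  push Not at hx
  obtain ⟨z, hz⟩ := hx
  refine ⟨(ρ ![v, x, z])⁻¹ • z, ?_⟩
  rw [← contractionBilin_apply, map_smul, contractionBilin_apply, smul_eq_mul, inv_mul_cancel₀ hz]

end TrilinearCalculus

section Symplectic

variable {V : Type*} [AddCommGroup V] [Module ℝ V] [FiniteDimensional ℝ V]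

theorem finrank_nullSpace_add_four {ρ : V [⋀^Fin 3]→ₗ[ℝ] ℝ} (hρ : IsDefinite3Form ρ)
    {v : V} (hv : v ≠ 0) : Module.finrank ℝ (nullSpace ρ v) + 4 = Module.finrank ℝ V := by
  have h := LinearMap.finrank_range_add_finrank_ker (contraction3 ρ v)
  rw [hρ v hv] at h
  rw [nullSpace]
  omega

/-- The 2-form `i_v ρ` of a definite 3-form admits a symplectic basis modulo its null space. -/
theorem exists_symplectic_frame {ρ : V [⋀^Fin 3]→ₗ[ℝ] ℝ} (hρ : IsDefinite3Form ρ)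
    {v : V} (hv : v ≠ 0) :
    ∃ e₁ f₁ e₂ f₂ : V, ρ ![v, e₁, f₁] = 1 ∧ ρ ![v, e₂, f₂] = 1 ∧ ρ ![v, e₁, e₂] = 0 ∧
      ρ ![v, e₁, f₂] = 0 ∧ ρ ![v, f₁, e₂] = 0 ∧ ρ ![v, f₁, f₂] = 0 := by
  have hN := finrank_nullSpace_add_four hρ hv
  obtain ⟨e₁, he₁⟩ : ∃ e₁, e₁ ∉ nullSpace ρ v := by
    by_contra! h
    rw [(Submodule.eq_top_iff').2 h, finrank_top] at hN
    omega
  obtain ⟨f₁, hf₁⟩ := exists_pairing_eq_one ρ he₁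
  let L : V →ₗ[ℝ] ℝ × ℝ := (contractionBilin ρ v e₁).prod (contractionBilin ρ v f₁)
  obtain ⟨e₂, he₂, he₂N⟩ : ∃ e₂ ∈ LinearMap.ker L, e₂ ∉ nullSpace ρ v := by
    by_contra! h
    have h1 := Submodule.finrank_mono (show LinearMap.ker L ≤ nullSpace ρ v from h)
    have h2 := LinearMap.finrank_range_add_finrank_ker L
    have h3 := Submodule.finrank_le (LinearMap.range L)
    rw [Module.finrank_prod, Module.finrank_self] at h3
    omega
  obtain ⟨he₁₂, hfe⟩ : ρ ![v, e₁, e₂] = 0 ∧ ρ ![v, f₁, e₂] = 0 := by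
    simpa [L] using he₂
  obtain ⟨z, hz⟩ := exists_pairing_eq_one ρ he₂N
  refine ⟨e₁, f₁, e₂, z + (-ρ ![v, e₁, z]) • f₁ + ρ ![v, f₁, z] • e₁, hf₁, ?_, he₁₂, ?_, hfe, ?_⟩
  all_goals simp only [threeForm_add_smul_right, threeForm_self_right, hf₁, hz,
    threeForm_swap_right ρ v e₁ f₁, threeForm_swap_right ρ v e₁ e₂,
    threeForm_swap_right ρ v f₁ e₂, he₁₂, hfe]
  all_goals ring

end Symplectic

/-- for a definite 3-form `ρ` and nonzero `v`, there is a
4-dimensional complement `Q` to the null space `N_v` on which `ρ` restricts to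
zero. -/
theorem exists_complement_on_which_rho_vanishes
    {V : Type*} [AddCommGroup V] [Module ℝ V] [FiniteDimensional ℝ V]
    (hdim : Module.finrank ℝ V = 6)
    (ρ : V [⋀^Fin 3]→ₗ[ℝ] ℝ) (hρ : IsDefinite3Form ρ)
    (v : V) (hv : v ≠ 0) :
    (∀ w : V, w ∈ nullSpace ρ v ↔ ∀ z : V, ρ ![v, w, z] = 0) ∧
    ∃ Q : Submodule ℝ V, Module.finrank ℝ Q = 4 ∧
      IsCompl (nullSpace ρ v) Q ∧
      ∀ q₁ q₂ q₃ : V, q₁ ∈ Q → q₂ ∈ Q → q₃ ∈ Q → ρ ![q₁, q₂, q₃] = 0 := by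
  refine ⟨mem_nullSpace_iff ρ v, ?_⟩
  obtain ⟨e₁, f₁, e₂, f₂, h₁, h₂, hee, hef, hfe, hff⟩ := exists_symplectic_frame hρ hv
  -- Shifting the frame by multiples of `v` keeps it symplectic and kills `ρ` on its span.
  let u : Fin 4 → V := ![e₁ + (-ρ ![e₁, e₂, f₂]) • v, f₁ + (-ρ ![f₁, e₂, f₂]) • v,
    e₂ + (-ρ ![e₁, f₁, e₂]) • v, f₂ + (-ρ ![e₁, f₁, f₂]) • v]
  have hpair : ∀ c ∈ (nullSpace ρ v).comap (Fintype.linearCombination ℝ u), c = 0 := by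
    intro c hc
    rw [Submodule.mem_comap, mem_nullSpace_iff] at hc
    have key : ∀ z, c 0 * ρ ![v, e₁, z] + c 1 * ρ ![v, f₁, z] + c 2 * ρ ![v, e₂, z]
        + c 3 * ρ ![v, f₂, z] = 0 := by
      intro z
      rw [← hc z, ← contractionBilin_apply ρ v (Fintype.linearCombination ℝ u c)]
      simp [Fintype.linearCombination_apply, Fin.sum_univ_four, u, threeForm_self_left]
    have k₀ := key f₁
    have k₁ := key e₁
    have k₂ := key f₂
    have k₃ := key e₂
    simp only [threeForm_self_right, threeForm_swap_right ρ v e₁ f₁, threeForm_swap_right ρ v e₁ e₂,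
      threeForm_swap_right ρ v e₁ f₂, threeForm_swap_right ρ v f₁ e₂,
      threeForm_swap_right ρ v f₁ f₂, threeForm_swap_right ρ v e₂ f₂,
      h₁, h₂, hee, hef, hfe, hff] at k₀ k₁ k₂ k₃
    ext i
    fin_cases i <;> simp <;> linarith
  have hinj : Function.Injective (Fintype.linearCombination ℝ u) := by
    rw [← LinearMap.ker_eq_bot, Submodule.eq_bot_iff]
    intro c hc
    refine hpair c ?_
    rw [Submodule.mem_comap, LinearMap.mem_ker.1 hc]
    exact Submodule.zero_mem _
  have hrank : Module.finrank ℝ (LinearMap.range (Fintype.linearCombination ℝ u)) = 4 := by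
    rw [LinearMap.finrank_range_of_inj hinj, Module.finrank_fin_fun]
  refine ⟨LinearMap.range (Fintype.linearCombination ℝ u), hrank, ?_, ?_⟩
  · refine (Submodule.isCompl_iff_disjoint _ _ ?_).2 ?_
    · rw [hrank, finrank_nullSpace_add_four hρ hv]
    · rw [Submodule.disjoint_def]
      rintro _ hx ⟨c, rfl⟩
      rw [hpair c hx, map_zero]
  · intro q₁ q₂ q₃ hq₁ hq₂ hq₃
    have hrot : ∀ x y, ρ ![x, y, v] = ρ ![v, x, y] := fun x y => by
      rw [threeForm_swap_right, threeForm_swap_left, neg_neg]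
    have hmid : ∀ x y, ρ ![x, v, y] = -ρ ![v, x, y] := fun x y => threeForm_swap_left ρ v x y
    have hself : ∀ x y, ρ ![x, y, x] = 0 := fun x y => by
      rw [threeForm_swap_right, threeForm_self_left, neg_zero]
    refine threeForm_eq_zero_on_range ρ u ?_ ?_ ?_ ?_ hq₁ hq₂ hq₃
    all_goals
      simp [-neg_smul, u, threeForm_add_smul_left, threeForm_add_smul_mid,
        threeForm_add_smul_right, threeForm_self_left, threeForm_self_right, hself]
      simp [hrot, hmid, h₁, h₂, hee, hef, hfe, hff]
end

section
/- Let ρ be a definite 3-form on a 6-dimensional real vector space V and let J be a complex structure compatible with ρ. Define ρ̃(x,y,z) = -ρ(Jx,y,z). Then ρ̃ is a well-defined alternating 3-form on V, the complex-valued form ρ + iρ̃ is alternating ℂ-trilinear with respect to J, and ρ̃ is itself a definite 3-form compatible with J (i.e. ρ̃(Jx,Jy,z) = -ρ̃(x,y,z) for all x,y,z). -/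
namespace AlternatingMap

variable {R M N : Type*} [CommRing R] [AddCommGroup M] [Module R M] [AddCommGroup N] [Module R N]

theorem map_vec_three_swap_fst_snd (f : M [⋀^Fin 3]→ₗ[R] N) (x y z : M) :
    f ![y, x, z] = -f ![x, y, z] := by
  rw [← f.map_swap ![x, y, z] (i := 0) (j := 1) (by decide)]
  congr 1
  ext i
  fin_cases i <;> rfl

theorem map_vec_three_swap_snd_thd (f : M [⋀^Fin 3]→ₗ[R] N) (x y z : M) :
    f ![x, z, y] = -f ![x, y, z] := by
  rw [← f.map_swap ![x, y, z] (i := 1) (j := 2) (by decide)]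
  congr 1
  ext i
  fin_cases i <;> rfl

theorem map_vec_three_rotate (f : M [⋀^Fin 3]→ₗ[R] N) (x y z : M) :
    f ![y, z, x] = f ![x, y, z] := by
  rw [f.map_vec_three_swap_snd_thd, f.map_vec_three_swap_fst_snd, neg_neg]

theorem map_vec_three_neg_fst (f : M [⋀^Fin 3]→ₗ[R] N) (x y z : M) :
    f ![-x, y, z] = -f ![x, y, z] := by
  simpa using f.map_vecCons_smul ![y, z] (-1 : R) x

end AlternatingMap

namespace IsCompatibleComplexStructure

variable {V : Type*} [AddCommGroup V] [Module ℝ V] {ρ : V [⋀^Fin 3]→ₗ[ℝ] ℝ} {J : V →ₗ[ℝ] V}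

theorem apply_apply (hJ : IsCompatibleComplexStructure ρ J) (x : V) : J (J x) = -x := by
  simpa using LinearMap.congr_fun hJ.1 x

theorem map_fst_eq_map_snd (hJ : IsCompatibleComplexStructure ρ J) (x y z : V) :
    ρ ![J x, y, z] = ρ ![x, J y, z] := by
  have h := hJ.2 (J x) y z
  rw [hJ.apply_apply, ρ.map_vec_three_neg_fst] at h
  linarith

theorem map_snd_eq_map_thd (hJ : IsCompatibleComplexStructure ρ J) (x y z : V) :
    ρ ![x, J y, z] = ρ ![x, y, J z] := by
  rw [← ρ.map_vec_three_rotate, hJ.map_fst_eq_map_snd, ρ.map_vec_three_rotate]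

/-- The alternating form `(x, y, z) ↦ -ρ (J x, y, z)`. -/
noncomputable def tilde (hJ : IsCompatibleComplexStructure ρ J) : V [⋀^Fin 3]→ₗ[ℝ] ℝ where
  toMultilinearMap :=
    -ρ.toMultilinearMap.compLinearMap ![J, LinearMap.id, LinearMap.id]
  map_eq_zero_of_eq' v i j hv hij := by
    have key : ρ ![J (v 0), v 1, v 2] = 0 := by
      have h₁ := hJ.map_fst_eq_map_snd (v 0) (v 1) (v 2)
      have h₂ := hJ.map_snd_eq_map_thd (v 0) (v 1) (v 2)
      have h₃ := ρ.map_vec_three_swap_fst_snd (v 0) (J (v 1)) (v 2)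
      have h₄ := ρ.map_vec_three_swap_snd_thd (v 0) (v 1) (J (v 2))
      have h₅ := ρ.map_vec_three_swap_fst_snd (v 0) (J (v 2)) (v 1)
      have h₆ := ρ.map_vec_three_swap_snd_thd (J (v 0)) (v 1) (v 2)
      fin_cases i <;> fin_cases j <;> simp at hv hij <;> simp only [hv] at * <;> linarith
    have hvec : (fun i ↦ (![J, LinearMap.id, LinearMap.id] : Fin 3 → V →ₗ[ℝ] V) i (v i)) =
        ![J (v 0), v 1, v 2] := by
      ext i
      fin_cases i <;> rfl
    change -ρ (fun i ↦ (![J, LinearMap.id, LinearMap.id] : Fin 3 → V →ₗ[ℝ] V) i (v i)) = 0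
    rw [hvec, key, neg_zero]

theorem tilde_apply (hJ : IsCompatibleComplexStructure ρ J) (x y z : V) :
    hJ.tilde ![x, y, z] = -ρ ![J x, y, z] := by
  change -ρ (fun i ↦ (![J, LinearMap.id, LinearMap.id] : Fin 3 → V →ₗ[ℝ] V) i (![x, y, z] i)) = _
  congr 2
  ext i
  fin_cases i <;> rfl

theorem tilde_map_fst (hJ : IsCompatibleComplexStructure ρ J) (x y z : V) :
    hJ.tilde ![J x, y, z] = ρ ![x, y, z] := by
  rw [hJ.tilde_apply, hJ.apply_apply, ρ.map_vec_three_neg_fst, neg_neg]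

theorem isCompatible_tilde (hJ : IsCompatibleComplexStructure ρ J) :
    IsCompatibleComplexStructure hJ.tilde J :=
  ⟨hJ.1, fun x y z ↦ by rw [hJ.tilde_apply, hJ.tilde_apply, hJ.2 (J x) y z]⟩

theorem contraction3_tilde (hJ : IsCompatibleComplexStructure ρ J) (v : V) :
    contraction3 hJ.tilde v = contraction3 ρ (-J v) := by
  ext x w
  obtain ⟨z, rfl⟩ : ∃ z, w = ![z] := ⟨w 0, by ext i; fin_cases i; rfl⟩
  change hJ.tilde ![v, x, z] = ρ ![-J v, x, z]
  rw [hJ.tilde_apply, ρ.map_vec_three_neg_fst]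

theorem isDefinite3Form_tilde (hJ : IsCompatibleComplexStructure ρ J) (hρ : IsDefinite3Form ρ) :
    IsDefinite3Form hJ.tilde := by
  intro v hv
  rw [hJ.contraction3_tilde]
  refine hρ _ fun h ↦ hv ?_
  simpa [neg_eq_zero.mp h] using (hJ.apply_apply v).symm

end IsCompatibleComplexStructure

/-- for a definite 3-form `ρ` with compatible complex structure `J`,
the formula `ρ̃(x,y,z) = -ρ(Jx,y,z)` defines an alternating 3-form `ρ̃`; the
complex-valued form `ρ + i ρ̃` is `ℂ`-trilinear for `J` (it is `ℝ`-trilinear and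
alternating with `i`-homogeneity in each slot), and `ρ̃` is itself a definite
3-form compatible with `J`. -/
theorem tilde_rho_exists_and_is_definite
    {V : Type*} [AddCommGroup V] [Module ℝ V] [FiniteDimensional ℝ V]
    (hdim : Module.finrank ℝ V = 6)
    (ρ : V [⋀^Fin 3]→ₗ[ℝ] ℝ) (hρ : IsDefinite3Form ρ)
    (J : V →ₗ[ℝ] V) (hJ : IsCompatibleComplexStructure ρ J) :
    ∃ ρt : V [⋀^Fin 3]→ₗ[ℝ] ℝ,
      (∀ x y z : V, ρt ![x, y, z] = - ρ ![J x, y, z]) ∧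
      (∀ x y z : V,
        ((ρ ![J x, y, z] : ℂ) + (ρt ![J x, y, z] : ℂ) * Complex.I)
          = Complex.I * ((ρ ![x, y, z] : ℂ) + (ρt ![x, y, z] : ℂ) * Complex.I)) ∧
      (∀ x y z : V,
        ((ρ ![x, J y, z] : ℂ) + (ρt ![x, J y, z] : ℂ) * Complex.I)
          = Complex.I * ((ρ ![x, y, z] : ℂ) + (ρt ![x, y, z] : ℂ) * Complex.I)) ∧
      (∀ x y z : V,
        ((ρ ![x, y, J z] : ℂ) + (ρt ![x, y, J z] : ℂ) * Complex.I)
          = Complex.I * ((ρ ![x, y, z] : ℂ) + (ρt ![x, y, z] : ℂ) * Complex.I)) ∧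
      IsDefinite3Form ρt ∧
      ∀ x y z : V, ρt ![J x, J y, z] = - ρt ![x, y, z] := by
  refine ⟨hJ.tilde, hJ.tilde_apply, fun x y z ↦ ?_, fun x y z ↦ ?_, fun x y z ↦ ?_,
    hJ.isDefinite3Form_tilde hρ, hJ.isCompatible_tilde.2⟩
  · rw [hJ.tilde_map_fst, hJ.tilde_apply]
    push_cast
    linear_combination (ρ ![J x, y, z] : ℂ) * Complex.I_sq
  · rw [← hJ.isCompatible_tilde.map_fst_eq_map_snd, ← hJ.map_fst_eq_map_snd,
      hJ.tilde_map_fst, hJ.tilde_apply]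
    push_cast
    linear_combination (ρ ![J x, y, z] : ℂ) * Complex.I_sq
  · rw [← hJ.isCompatible_tilde.map_snd_eq_map_thd, ← hJ.isCompatible_tilde.map_fst_eq_map_snd,
      ← hJ.map_snd_eq_map_thd, ← hJ.map_fst_eq_map_snd, hJ.tilde_map_fst, hJ.tilde_apply]
    push_cast
    linear_combination (ρ ![J x, y, z] : ℂ) * Complex.I_sq
end
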